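/- arXiv:1707.04965 — 3 statements merged into one kernel-verified Lean document; each statement's English description precedes it below -/
import Mathlib

section
/- There exist positive constants c1 and c2 such that for every integer H ≥ 3, c1·H^4 ≤ #I*_4(H) ≤ c2·H^4, where #I*_4(H) is the number of generalized degenerate integer polynomials (not necessarily monic) of degree 4 and height at most H that are irreducible over ℤ. -/
open Polynomial MeasureTheory

/-- A finite set of (nonzero) complex numbers is multiplicatively dependent:
there are integer exponents, not all zero, whose corresponding power product is 1. -/
def MulDep (S : Finset ℂ) : Prop :=
  ∃ k : ℂ → ℤ, (∃ z ∈ S, k z ≠ 0) ∧ ∏ z ∈ S, z ^ k z = 1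

/-- The distinct nonzero complex roots of an integer polynomial. -/
noncomputable def nzRoots (f : Polynomial ℤ) : Finset ℂ :=
  ((f.map (Int.castRingHom ℂ)).roots.toFinset).filter (fun z => z ≠ 0)

/-- A polynomial of degree at least 2 is generalized degenerate if its distinct
nonzero complex roots are multiplicatively dependent. -/
def GenDeg (f : Polynomial ℤ) : Prop :=
  2 ≤ f.natDegree ∧ MulDep (nzRoots f)

/-- Height (max absolute value of coefficients) at most `H`. -/
def HeightLe (f : Polynomial ℤ) (H : ℤ) : Prop :=
  ∀ i, |f.coeff i| ≤ H

def Iset (n : ℕ) (H : ℤ) : Set (Polynomial ℤ) :=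
  {f | f.Monic ∧ f.natDegree = n ∧ HeightLe f H ∧ Irreducible f ∧ GenDeg f}

def Rset (n : ℕ) (H : ℤ) : Set (Polynomial ℤ) :=
  {f | f.Monic ∧ f.natDegree = n ∧ HeightLe f H ∧ ¬ Irreducible f ∧ GenDeg f}

def Mset (n : ℕ) (H : ℤ) : Set (Polynomial ℤ) :=
  {f | f.Monic ∧ f.natDegree = n ∧ HeightLe f H ∧ GenDeg f}

def IstarSet (n : ℕ) (H : ℤ) : Set (Polynomial ℤ) :=
  {f | f.natDegree = n ∧ HeightLe f H ∧ Irreducible f ∧ GenDeg f}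

def RstarSet (n : ℕ) (H : ℤ) : Set (Polynomial ℤ) :=
  {f | f.natDegree = n ∧ HeightLe f H ∧ ¬ Irreducible f ∧ GenDeg f}

def MstarSet (n : ℕ) (H : ℤ) : Set (Polynomial ℤ) :=
  {f | f.natDegree = n ∧ HeightLe f H ∧ GenDeg f}

/-- `nu n` is the (n-1)-dimensional Lebesgue volume of the convex body
`|x_i| ≤ 1 (1 ≤ i ≤ n-1)`, `|x_1 + ⋯ + x_{n-1}| ≤ 1`. -/
noncomputable def nu (n : ℕ) : ℝ :=
  (volume {x : Fin (n - 1) → ℝ | (∀ i, |x i| ≤ 1) ∧ |∑ i, x i| ≤ 1}).toReal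

/-- A transitive set of permutations of four letters generates, by words of length three,
a four-cycle or the Klein four-group. -/
lemma exists_fourCycle_or_klein :
    ∀ g : Equiv.Perm (Fin 4), g 0 = 1 → ∀ h : Equiv.Perm (Fin 4), h 0 = 2 →
    ∀ k : Equiv.Perm (Fin 4), k 0 = 3 →
      (∃ a ∈ [1, g, h, k], ∃ b ∈ [1, g, h, k], ∃ c ∈ [1, g, h, k],
        ∃ τ ∈ [1, Equiv.swap 0 1, Equiv.swap 1 2, Equiv.swap 2 3, Equiv.swap 0 2, Equiv.swap 1 3],
          a * b * c = τ * finRotate 4 * τ⁻¹) ∨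
      (∀ v ∈ [Equiv.swap (0 : Fin 4) 1 * Equiv.swap 2 3, Equiv.swap 0 2 * Equiv.swap 1 3,
          Equiv.swap 0 3 * Equiv.swap 1 2],
        ∃ a ∈ [1, g, h, k], ∃ b ∈ [1, g, h, k], ∃ c ∈ [1, g, h, k], a * b * c = v) := by
  decide +kernel

/-- The subgroup `R` contains a nonzero multiple of a rearrangement of one of the vectors
`(1, 1, 1, 1)`, `(1, -1, 0, 0)`, `(1, 1, -1, -1)`. -/
def HasBasicRelation (R : AddSubgroup (Fin 4 → ℤ)) : Prop :=
  ∃ τ : Equiv.Perm (Fin 4), ∃ N : ℤ, N ≠ 0 ∧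
    (N • (![1, 1, 1, 1] ∘ τ) ∈ R ∨ N • (![1, -1, 0, 0] ∘ τ) ∈ R ∨ N • (![1, 1, -1, -1] ∘ τ) ∈ R)

lemma hasBasicRelation_of_klein (R : AddSubgroup (Fin 4 → ℤ)) (m : Fin 4 → ℤ) (hm : m ≠ 0)
    (h0 : m ∈ R)
    (h1 : ![m 1, m 0, m 3, m 2] ∈ R)
    (h2 : ![m 2, m 3, m 0, m 1] ∈ R)
    (h3 : ![m 3, m 2, m 1, m 0] ∈ R) : HasBasicRelation R := by
  by_cases ha : m 0 + m 1 + m 2 + m 3 = 0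
  · by_cases hb : m 0 + m 1 - m 2 - m 3 = 0
    · by_cases hc : m 0 - m 1 + m 2 - m 3 = 0
      · by_cases hd : m 0 - m 1 - m 2 + m 3 = 0
        · exfalso
          apply hm
          funext i
          fin_cases i <;> simp <;> omega
        · refine ⟨Equiv.swap 1 3, _, hd, Or.inr (Or.inr ?_)⟩
          convert R.add_mem (R.sub_mem (R.sub_mem h0 h1) h2) h3 using 1
          ext i
          fin_cases i <;> simp [Equiv.swap_apply_def, Matrix.vecHead, Matrix.vecTail] <;> omega
      · refine ⟨Equiv.swap 1 2, _, hc, Or.inr (Or.inr ?_)⟩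
        convert R.sub_mem (R.add_mem (R.sub_mem h0 h1) h2) h3 using 1
        ext i
        fin_cases i <;> simp [Equiv.swap_apply_def, Matrix.vecHead, Matrix.vecTail] <;> omega
    · refine ⟨1, _, hb, Or.inr (Or.inr ?_)⟩
      convert R.sub_mem (R.sub_mem (R.add_mem h0 h1) h2) h3 using 1
      ext i
      fin_cases i <;> simp [Matrix.vecHead, Matrix.vecTail] <;> omega
  · refine ⟨1, _, ha, Or.inl ?_⟩
    convert R.add_mem (R.add_mem (R.add_mem h0 h1) h2) h3 using 1
    ext i
    fin_cases i <;> simp [Matrix.vecHead, Matrix.vecTail] <;> omega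

lemma hasBasicRelation_of_rotate (R : AddSubgroup (Fin 4 → ℤ)) (m : Fin 4 → ℤ) (hm : m ≠ 0)
    (h0 : m ∈ R) (h : ∀ m ∈ R, m ∘ finRotate 4 ∈ R) : HasBasicRelation R := by
  have h1 := h _ h0
  have h2 := h _ h1
  have h3 := h _ h2
  by_cases ha : m 0 + m 1 + m 2 + m 3 = 0
  · by_cases hb : m 0 - m 1 + m 2 - m 3 = 0
    · refine ⟨Equiv.swap 1 2, m 0 * m 0 + m 1 * m 1, ?_, Or.inr (Or.inl ?_)⟩
      · intro h
        have hx : m 0 = 0 := by nlinarith [mul_self_nonneg (m 0), mul_self_nonneg (m 1)]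
        have hy : m 1 = 0 := by nlinarith [mul_self_nonneg (m 0), mul_self_nonneg (m 1)]
        apply hm
        funext i
        fin_cases i <;> simp <;> omega
      · have e2 : m 2 = - m 0 := by omega
        have e3 : m 3 = - m 1 := by omega
        convert R.add_mem (R.zsmul_mem h0 (m 0)) (R.zsmul_mem h1 (m 1)) using 1
        ext i
        fin_cases i <;> simp [Equiv.swap_apply_def, e2, e3] <;> ring
    · refine ⟨Equiv.swap 1 2, _, hb, Or.inr (Or.inr ?_)⟩
      convert R.sub_mem (R.add_mem (R.sub_mem h0 h1) h2) h3 using 1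
      ext i
      fin_cases i <;> simp [Equiv.swap_apply_def] <;> ring
  · refine ⟨1, _, ha, Or.inl ?_⟩
    convert R.add_mem (R.add_mem (R.add_mem h0 h1) h2) h3 using 1
    ext i
    fin_cases i <;> simp <;> ring

lemma hasBasicRelation_of_transitive (R : AddSubgroup (Fin 4 → ℤ)) (m : Fin 4 → ℤ) (hm : m ≠ 0)
    (h0 : m ∈ R)
    (h : ∀ i, ∃ σ : Equiv.Perm (Fin 4), σ 0 = i ∧ ∀ m ∈ R, m ∘ σ ∈ R) :
    HasBasicRelation R := by
  obtain ⟨g, hg, hgR⟩ := h 1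
  obtain ⟨g', hg', hgR'⟩ := h 2
  obtain ⟨g'', hg'', hgR''⟩ := h 3
  have hmem : ∀ a ∈ [1, g, g', g''], ∀ m ∈ R, m ∘ a ∈ R := by
    intro a ha
    simp only [List.mem_cons, List.not_mem_nil, or_false] at ha
    rcases ha with rfl | rfl | rfl | rfl
    · intro m hm
      simpa using hm
    all_goals assumption
  have hword : ∀ a ∈ [1, g, g', g''], ∀ b ∈ [1, g, g', g''], ∀ c ∈ [1, g, g', g''],
      ∀ m ∈ R, m ∘ (a * b * c) ∈ R := fun a ha b hb c hc m hm =>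
    hmem c hc _ (hmem b hb _ (hmem a ha m hm))
  rcases exists_fourCycle_or_klein g hg g' hg' g'' hg'' with
    ⟨a, ha, b, hb, c, hc, τ, -, habc⟩ | hv
  · let T : (Fin 4 → ℤ) →+ (Fin 4 → ℤ) :=
      { toFun := fun m => m ∘ ⇑τ⁻¹, map_zero' := rfl, map_add' := fun _ _ => rfl }
    have key : HasBasicRelation (R.comap T) := by
      refine hasBasicRelation_of_rotate _ (m ∘ τ) ?_ ?_ ?_
      · intro hz
        apply hm
        funext i
        simpa using congrFun hz (τ⁻¹ i)
      · change (m ∘ τ) ∘ ⇑τ⁻¹ ∈ R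
        convert h0 using 1
        ext i
        simp
      · intro n hn
        have := hword a ha b hb c hc _ hn
        rw [habc] at this
        change (n ∘ finRotate 4) ∘ ⇑τ⁻¹ ∈ R
        convert this using 1
        ext i
        simp [T]
    obtain ⟨ρ, N, hN, hR⟩ := key
    exact ⟨ρ * τ⁻¹, N, hN, hR⟩
  · have hv' : ∀ v : Equiv.Perm (Fin 4), v ∈ [Equiv.swap (0 : Fin 4) 1 * Equiv.swap 2 3,
        Equiv.swap 0 2 * Equiv.swap 1 3, Equiv.swap 0 3 * Equiv.swap 1 2] → m ∘ v ∈ R := by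
      intro v hvl
      obtain ⟨a, ha, b, hb, c, hc, rfl⟩ := hv v hvl
      exact hword a ha b hb c hc m h0
    refine hasBasicRelation_of_klein R m hm h0 ?_ ?_ ?_
    · convert hv' (Equiv.swap 0 1 * Equiv.swap 2 3) (by simp) using 1
      ext i
      fin_cases i <;> rfl
    · convert hv' (Equiv.swap 0 2 * Equiv.swap 1 3) (by simp) using 1
      ext i
      fin_cases i <;> rfl
    · convert hv' (Equiv.swap 0 3 * Equiv.swap 1 2) (by simp) using 1
      ext i
      fin_cases i <;> rfl

lemma exists_dvd_of_totient_le (B : ℕ) :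
    ∃ M : ℕ, 0 < M ∧ ∀ n : ℕ, 0 < n → n.totient ≤ B → n ∣ M := by
  refine ⟨((B + 1).factorial) ^ (B + 1), by positivity, fun n hn hB => ?_⟩
  rw [Nat.dvd_iff_prime_pow_dvd_dvd]
  intro p k hp hk
  rcases Nat.eq_zero_or_pos k with rfl | hk0
  · simp
  have h1 : (p ^ k).totient ≤ B :=
    (Nat.le_of_dvd (Nat.totient_pos.2 hn) (Nat.totient_dvd_of_dvd hk)).trans hB
  rw [Nat.totient_prime_pow hp hk0] at h1
  have hp2 := hp.two_le
  have h2 : p - 1 ≤ B := (Nat.le_mul_of_pos_left _ (by positivity)).trans h1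
  have h3 : p ^ (k - 1) ≤ B := (Nat.le_mul_of_pos_right _ (by omega)).trans h1
  have h4 : k - 1 < p ^ (k - 1) := Nat.lt_pow_self hp.one_lt
  calc p ^ k ∣ p ^ (B + 1) := pow_dvd_pow _ (by omega)
    _ ∣ _ := pow_dvd_pow_of_dvd (Nat.dvd_factorial hp.pos (by omega)) _

lemma exists_pow_eq_one_of_finrank_le (B : ℕ) :
    ∃ M : ℕ, 0 < M ∧ ∀ (K : Type) [Field K] [Algebra ℚ K] [FiniteDimensional ℚ K],
      Module.finrank ℚ K ≤ B → ∀ (u : K) (N : ℕ), 0 < N → u ^ N = 1 → u ^ M = 1 := by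
  obtain ⟨M, hM, h⟩ := exists_dvd_of_totient_le B
  refine ⟨M, hM, fun K _ inst _ hK u N hN hu => ?_⟩
  have hpos : 0 < orderOf u := orderOf_pos_iff.2 (isOfFinOrder_iff_pow_eq_one.2 ⟨N, hN, hu⟩)
  have := charZero_of_injective_algebraMap (algebraMap ℚ K).injective
  obtain rfl : inst = DivisionRing.toRatAlgebra := Subsingleton.elim _ _
  have hdeg := congrArg natDegree (cyclotomic_eq_minpoly_rat (IsPrimitiveRoot.orderOf u) hpos)
  rw [natDegree_cyclotomic] at hdeg
  exact orderOf_dvd_iff_pow_eq_one.1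
    (h _ hpos (hdeg ▸ (minpoly.natDegree_le u).trans hK))

lemma normal_splittingField {F : Type*} [Field F] (p : F[X]) : Normal F p.SplittingField :=
  Normal.of_isSplittingField p

lemma finrank_splittingField_le_factorial {F : Type*} [Field F] {p : F[X]} (hp : p.Separable) :
    Module.finrank F p.SplittingField ≤ p.natDegree.factorial := by
  classical
  have hspl : (p.map (algebraMap F p.SplittingField)).Splits := SplittingField.splits p
  have : Fact (p.map (algebraMap F p.SplittingField)).Splits := ⟨hspl⟩
  rw [← Gal.card_of_separable hp]
  refine (Nat.card_le_card_of_injective _ (Gal.galActionHom_injective p p.SplittingField)).trans ?_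
  rw [Nat.card_eq_fintype_card, Fintype.card_perm,
    card_rootSet_eq_natDegree hp hspl]

lemma irreducible_map_rat {f : ℤ[X]} (hf : Irreducible f) (hd : f.natDegree ≠ 0) :
    Irreducible (f.map (Int.castRingHom ℚ)) :=
  (IsPrimitive.Int.irreducible_iff_irreducible_map_cast (hf.isPrimitive hd)).1 hf

lemma coeff_zero_ne_zero_of_irreducible {f : ℤ[X]} (hf : Irreducible f) (hd : 2 ≤ f.natDegree) :
    f.coeff 0 ≠ 0 := by
  intro h
  obtain ⟨g, hg⟩ := X_dvd_iff.2 h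
  have hg0 : g ≠ 0 := by
    rintro rfl
    simp [hg] at hd
  rcases hf.isUnit_or_isUnit hg with h1 | h1
  · exact not_isUnit_X h1
  · rw [hg, natDegree_X_mul hg0, natDegree_eq_zero_of_isUnit h1] at hd
    omega

lemma map_complex_eq_prod {f : ℤ[X]} {n : ℕ} (hd : f.natDegree = n) (hf : f ≠ 0) {z : Fin n → ℂ}
    (hz : Function.Injective z) (hroot : ∀ i, (f.map (Int.castRingHom ℂ)).IsRoot (z i)) :
    (f.map (Int.castRingHom ℂ)).roots = Finset.univ.val.map z ∧
    f.map (Int.castRingHom ℂ) = C (f.leadingCoeff : ℂ) * ∏ i, (X - C (z i)) := by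
  have hinj : Function.Injective (Int.castRingHom ℂ) := Int.cast_injective
  have h0 : f.map (Int.castRingHom ℂ) ≠ 0 := (Polynomial.map_ne_zero_iff hinj).2 hf
  have hroots : (f.map (Int.castRingHom ℂ)).roots = Finset.univ.val.map z := by
    symm
    refine Multiset.eq_of_le_of_card_le ?_ ?_
    · refine (Multiset.le_iff_subset (Finset.univ.nodup.map hz)).2 fun x hx => ?_
      obtain ⟨i, -, rfl⟩ := Multiset.mem_map.1 hx
      exact (mem_roots h0).2 (hroot i)
    · refine (card_roots' _).trans ?_
      rw [natDegree_map_eq_of_injective hinj, hd]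
      simp
  refine ⟨hroots, ?_⟩
  have h := (IsAlgClosed.splits (f.map (Int.castRingHom ℂ))).eq_prod_roots
  rw [hroots, Multiset.map_map, leadingCoeff_map_of_injective hinj] at h
  exact h

/-- The exponents of the multiplicative relations among the entries of `w`. -/
def relationSubgroup {K : Type*} [Field K] {n : ℕ} (w : Fin n → K) (hw : ∀ i, w i ≠ 0) :
    AddSubgroup (Fin n → ℤ) where
  carrier := {m | ∏ i, w i ^ m i = 1}
  zero_mem' := by simp
  add_mem' := by
    intro a b ha hb
    simp only [Set.mem_ofPred_eq, Pi.add_apply] at *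
    simp only [zpow_add₀ (hw _), Finset.prod_mul_distrib, ha, hb, one_mul]
  neg_mem' := by
    intro a ha
    simp only [Set.mem_ofPred_eq, Pi.neg_apply] at *
    simp [ha]

lemma mem_relationSubgroup {K : Type*} [Field K] {n : ℕ} {w : Fin n → K} {hw : ∀ i, w i ≠ 0}
    {m : Fin n → ℤ} : m ∈ relationSubgroup w hw ↔ ∏ i, w i ^ m i = 1 := Iff.rfl

lemma zpow_pow_eq_one {K : Type*} [Field K] {M : ℕ}
    (hM : ∀ (u : K) (N : ℕ), 0 < N → u ^ N = 1 → u ^ M = 1) {u : K} {N : ℤ} (hN : N ≠ 0)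
    (h : u ^ N = 1) : u ^ M = 1 := by
  refine hM u N.natAbs (Int.natAbs_pos.2 hN) ?_
  rcases Int.natAbs_eq N with h' | h'
  · rwa [h', zpow_natCast] at h
  · rwa [h', zpow_neg, inv_eq_one, zpow_natCast] at h

lemma exists_rearrangement_relation {K : Type*} [Field K] {M : ℕ}
    (hM : ∀ (u : K) (N : ℕ), 0 < N → u ^ N = 1 → u ^ M = 1) {w : Fin 4 → K} (hw : ∀ i, w i ≠ 0)
    (h : HasBasicRelation (relationSubgroup w hw)) :
    ∃ τ : Equiv.Perm (Fin 4),
      (w (τ 0) * w (τ 1) * w (τ 2) * w (τ 3)) ^ M = 1 ∨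
      w (τ 0) ^ M = w (τ 1) ^ M ∨
      (w (τ 0) * w (τ 1)) ^ M = (w (τ 2) * w (τ 3)) ^ M := by
  obtain ⟨τ, N, hN, h⟩ := h
  refine ⟨τ⁻¹, ?_⟩
  have key : ∀ v : Fin 4 → ℤ, N • (v ∘ τ) ∈ relationSubgroup w hw →
      (w (τ⁻¹ 0) ^ v 0 * w (τ⁻¹ 1) ^ v 1 * w (τ⁻¹ 2) ^ v 2 * w (τ⁻¹ 3) ^ v 3) ^ M = 1 := by
    intro v hv
    refine zpow_pow_eq_one hM hN ?_
    rw [mem_relationSubgroup, ← Equiv.prod_comp τ⁻¹, Fin.prod_univ_four] at hv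
    simpa [mul_zpow, mul_comm N, zpow_mul] using hv
  rcases h with h | h | h
  · left
    simpa using key _ h
  · right; left
    have := key _ h
    simp only [Matrix.cons_val, zpow_one, zpow_neg, zpow_zero, mul_one] at this
    rw [← div_eq_mul_inv, div_pow, div_eq_one_iff_eq (pow_ne_zero _ (hw _))] at this
    exact this
  · right; right
    have := key _ h
    simp only [Matrix.cons_val, zpow_one, zpow_neg] at this
    rw [mul_assoc, ← mul_inv, ← div_eq_mul_inv, div_pow,
      div_eq_one_iff_eq (pow_ne_zero _ (mul_ne_zero (hw _) (hw _)))] at this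
    exact this

lemma exists_perm_of_algEquiv {F K : Type*} [Field F] [Field K] [Algebra F K] {p : F[X]}
    {n : ℕ} (w : Fin n ≃ p.rootSet K) (σ : K ≃ₐ[F] K) :
    ∃ π : Equiv.Perm (Fin n), ∀ i, (w (π i) : K) = σ (w i) := by
  have hmem : ∀ i, σ (w i : K) ∈ p.rootSet K := fun i => by
    have h := (mem_rootSet.1 (w i).2)
    refine mem_rootSet.2 ⟨h.1, ?_⟩
    rw [← AlgEquiv.coe_toAlgHom, aeval_algHom_apply, h.2, map_zero]
  have hinj : Function.Injective fun i => w.symm ⟨σ (w i : K), hmem i⟩ := by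
    intro i j hij
    exact w.injective (Subtype.ext (σ.injective (Subtype.ext_iff.1 (w.symm.injective hij))))
  exact ⟨Equiv.ofBijective _ (Finite.injective_iff_bijective.1 hinj), fun i => by simp⟩

/-- Multiplicatively dependent roots of an irreducible integer quartic satisfy one of three basic
relations with a universal exponent. -/
lemma exists_root_relation :
    ∃ M : ℕ, 0 < M ∧ ∀ f : ℤ[X], f.natDegree = 4 → Irreducible f → MulDep (nzRoots f) →
      ∃ z : Fin 4 → ℂ, Function.Injective z ∧
        f.map (Int.castRingHom ℂ) = C (f.leadingCoeff : ℂ) * ∏ i, (X - C (z i)) ∧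
        ((z 0 * z 1 * z 2 * z 3) ^ M = 1 ∨ z 0 ^ M = z 1 ^ M ∨
          (z 0 * z 1) ^ M = (z 2 * z 3) ^ M) := by
  obtain ⟨M, hM, hMK⟩ := exists_pow_eq_one_of_finrank_le (Nat.factorial 4)
  refine ⟨M, hM, fun f hd hf hdep => ?_⟩
  set p : ℚ[X] := f.map (Int.castRingHom ℚ) with hp
  have hpd : p.natDegree = 4 := by
    rw [hp, natDegree_map_eq_of_injective Int.cast_injective, hd]
  have hpi : Irreducible p := irreducible_map_rat hf (by omega)
  have hspl : (p.map (algebraMap ℚ p.SplittingField)).Splits := SplittingField.splits p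
  have : Normal ℚ p.SplittingField := by
    convert normal_splittingField p
    exact Subsingleton.elim _ _
  have hMK' := hMK p.SplittingField (by
    rw [← hpd]
    convert finrank_splittingField_le_factorial hpi.separable)
  obtain ⟨w⟩ : Nonempty (Fin 4 ≃ p.rootSet p.SplittingField) :=
    ⟨(Fintype.equivFinOfCardEq
      ((card_rootSet_eq_natDegree hpi.separable hspl).trans hpd)).symm⟩
  have hcomp : (f.map (Int.castRingHom ℂ)) = p.map (algebraMap ℚ ℂ) := by
    rw [hp, Polynomial.map_map]
    congr 1
  let φ : p.SplittingField →ₐ[ℚ] ℂ := IsAlgClosed.lift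
  have hφ : Function.Injective φ := φ.injective
  set z : Fin 4 → ℂ := fun i => φ (w i) with hz
  have hzinj : Function.Injective z := fun i j hij => w.injective (Subtype.ext (hφ hij))
  have hzroot : ∀ i, (f.map (Int.castRingHom ℂ)).IsRoot (z i) := by
    intro i
    rw [hcomp, IsRoot.def, eval_map_algebraMap, hz, aeval_algHom_apply,
      (mem_rootSet.1 (w i).2).2, map_zero]
  obtain ⟨hroots, hprod⟩ := map_complex_eq_prod hd hf.ne_zero hzinj hzroot
  have hz0 : ∀ i, z i ≠ 0 := by
    intro i hi
    have h := hzroot i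
    rw [hi, IsRoot.def, ← coeff_zero_eq_eval_zero, coeff_map] at h
    exact coeff_zero_ne_zero_of_irreducible hf (by omega) (by simpa using h)
  have hw0 : ∀ i, (w i : p.SplittingField) ≠ 0 := by
    intro i hi
    apply hz0 i
    simp [hz, hi]
  have hnz : nzRoots f = Finset.univ.image z := by
    rw [nzRoots, hroots]
    ext x
    simp only [Finset.mem_filter, Multiset.mem_toFinset, Multiset.mem_map, Finset.mem_image,
      Finset.mem_val]
    constructor
    · rintro ⟨h, -⟩
      exact h
    · rintro ⟨i, hi, rfl⟩
      exact ⟨⟨i, hi, rfl⟩, hz0 i⟩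
  obtain ⟨k, ⟨x, hx, hkx⟩, hk⟩ := hdep
  rw [hnz] at hx hk
  rw [Finset.prod_image hzinj.injOn] at hk
  obtain ⟨i₀, -, rfl⟩ := Finset.mem_image.1 hx
  have hbasic : HasBasicRelation (relationSubgroup (fun i => (w i : p.SplittingField)) hw0) := by
    refine hasBasicRelation_of_transitive _ (fun i => k (z i)) (fun h => hkx (congrFun h i₀)) ?_ ?_
    · rw [mem_relationSubgroup]
      apply hφ
      simpa [hz] using hk
    · intro i
      have hmin : minpoly ℚ (w 0 : p.SplittingField) = minpoly ℚ (w i : p.SplittingField) := by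
        rw [← minpoly.eq_of_irreducible hpi (mem_rootSet.1 (w 0).2).2,
          ← minpoly.eq_of_irreducible hpi (mem_rootSet.1 (w i).2).2]
      obtain ⟨σ, hσ⟩ := minpoly.exists_algEquiv_of_root' (K := ℚ)
        (Algebra.IsAlgebraic.isAlgebraic (w 0 : p.SplittingField))
        (x := (w i : p.SplittingField)) (by rw [hmin, minpoly.aeval])
      obtain ⟨π, hπ⟩ := exists_perm_of_algEquiv w σ
      refine ⟨π, w.injective (Subtype.ext (by rw [hπ, hσ])), fun m hm => ?_⟩
      rw [mem_relationSubgroup] at hm ⊢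
      apply σ.injective
      rw [map_prod, map_one, ← hm,
        ← Equiv.prod_comp π fun i => (w i : p.SplittingField) ^ m i]
      simp [hπ]
  obtain ⟨τ, hτ⟩ := exists_rearrangement_relation hMK' hw0 hbasic
  refine ⟨z ∘ τ, hzinj.comp τ.injective, ?_, ?_⟩
  · rw [hprod, ← Equiv.prod_comp τ]
    rfl
  · simp only [hz, Function.comp_apply, ← map_mul, ← map_pow]
    rcases hτ with h | h | h
    · left; rw [h, map_one]
    · right; left; rw [h]
    · right; right; rw [h]

lemma vieta_quartic {f : ℤ[X]} {a : ℂ} {z : Fin 4 → ℂ}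
    (h : f.map (Int.castRingHom ℂ) = C a * ∏ i, (X - C (z i))) :
    (f.coeff 4 : ℂ) = a ∧ (f.coeff 3 : ℂ) = -a * (z 0 + z 1 + z 2 + z 3) ∧
    (f.coeff 2 : ℂ) = a * (z 0 * z 1 + (z 0 + z 1) * (z 2 + z 3) + z 2 * z 3) ∧
    (f.coeff 1 : ℂ) = -a * (z 0 * z 1 * (z 2 + z 3) + (z 0 + z 1) * (z 2 * z 3)) ∧
    (f.coeff 0 : ℂ) = a * (z 0 * z 1 * z 2 * z 3) := by
  have hexp : C a * ∏ i, (X - C (z i)) = C a * X ^ 4 + C (-a * (z 0 + z 1 + z 2 + z 3)) * X ^ 3 +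
      C (a * (z 0 * z 1 + (z 0 + z 1) * (z 2 + z 3) + z 2 * z 3)) * X ^ 2 +
      C (-a * (z 0 * z 1 * (z 2 + z 3) + (z 0 + z 1) * (z 2 * z 3))) * X +
      C (a * (z 0 * z 1 * z 2 * z 3)) := by
    simp only [Fin.prod_univ_four, map_mul, map_add, map_neg]
    ring
  have hc : ∀ i, (f.coeff i : ℂ) = (f.map (Int.castRingHom ℂ)).coeff i := fun i => by
    rw [coeff_map, eq_intCast]
  simp only [hc, h, hexp]
  refine ⟨?_, ?_, ?_, ?_, ?_⟩ <;>
    simp [coeff_X, coeff_C, -map_mul, -map_add, -map_neg, coeff_X_pow, -neg_mul, -mul_eq_mul_left_iff]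

/-- The integer vectors of length `n` with entries of absolute value at most `H`. -/
noncomputable def intBox (n : ℕ) (H : ℤ) : Finset (Fin n → ℤ) :=
  Fintype.piFinset fun _ => Finset.Icc (-H) H

lemma card_intBox (n : ℕ) {H : ℤ} : (intBox n H).card = (2 * H + 1).toNat ^ n := by
  rw [intBox, Fintype.card_piFinset_const, Int.card_Icc]
  congr 2
  ring

lemma card_filter_intBox_le {n : ℕ} (H : ℤ) (j : Fin (n + 1)) (N : ℕ)
    (T : (Fin n → ℤ) → Finset ℂ) (hT : ∀ y, (T y).card ≤ N) :
    ((intBox (n + 1) H).filter fun v => (v j : ℂ) ∈ T (j.removeNth v)).card ≤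
      N * (2 * H + 1).toNat ^ n := by
  rw [← card_intBox n]
  refine Finset.card_le_mul_card_image_of_maps_to (f := fun v => j.removeNth v) ?_ N ?_
  · intro v hv
    have hv' := Fintype.mem_piFinset.1 (Finset.mem_filter.1 hv).1
    exact Fintype.mem_piFinset.2 fun i => hv' _
  · intro y _
    refine (Finset.card_le_card_of_injOn (fun v => (v j : ℂ)) ?_ ?_).trans (hT y)
    · intro v hv
      simp only [Finset.coe_filter, Finset.mem_filter, Set.mem_ofPred_eq] at hv
      rw [← hv.2]
      exact hv.1.2
    · intro v hv v' hv' heq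
      simp only [Finset.coe_filter, Finset.mem_filter, Set.mem_ofPred_eq] at hv hv'
      have hj : v j = v' j := Int.cast_injective (α := ℂ) heq
      rw [← Fin.insertNth_self_removeNth j v, ← Fin.insertNth_self_removeNth j v', hj, hv.2, hv'.2]

lemma card_nthRootsFinset_le (M : ℕ) : (nthRootsFinset M (1 : ℂ)).card ≤ M := by
  classical
  rw [nthRootsFinset]
  exact (Multiset.toFinset_card_le _).trans (card_nthRoots M 1)

/-- Candidates for the constant coefficient of a quartic with the other coefficients given by `y`
whose roots have product a root of unity of order dividing `M`. -/
noncomputable def constCoeffOfProd (M : ℕ) (y : Fin 4 → ℤ) : Finset ℂ :=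
  (nthRootsFinset M (1 : ℂ)).image fun ζ => y 3 * ζ

lemma card_constCoeffOfProd_le (M : ℕ) (y : Fin 4 → ℤ) : (constCoeffOfProd M y).card ≤ M :=
  Finset.card_image_le.trans (card_nthRootsFinset_le M)

/-- The polynomial `g(X) - g(ζX)` for `g(X) = y₃X⁴ + y₂X³ + y₁X² + y₀X`. -/
noncomputable def twistDiff (y : Fin 4 → ℤ) (ζ : ℂ) : ℂ[X] :=
  C (y 3 * (1 - ζ ^ 4)) * X ^ 4 + C (y 2 * (1 - ζ ^ 3)) * X ^ 3 + C (y 1 * (1 - ζ ^ 2)) * X ^ 2 +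
    C (y 0 * (1 - ζ)) * X

/-- Candidates for the constant coefficient of a quartic with the other coefficients given by `y`
having two roots whose ratio is a root of unity of order dividing `M`. -/
noncomputable def constCoeffOfRatio (M : ℕ) (y : Fin 4 → ℤ) : Finset ℂ :=
  (nthRootsFinset M (1 : ℂ)).biUnion fun ζ =>
    (twistDiff y ζ).roots.toFinset.image fun x => -(y 3 * x ^ 4 + y 2 * x ^ 3 + y 1 * x ^ 2 + y 0 * x)

lemma card_constCoeffOfRatio_le (M : ℕ) (y : Fin 4 → ℤ) :
    (constCoeffOfRatio M y).card ≤ M * 4 := by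
  refine (Finset.card_biUnion_le_card_mul _ _ 4 fun ζ _ => ?_).trans
    (Nat.mul_le_mul_right _ (card_nthRootsFinset_le M))
  refine Finset.card_image_le.trans ((Multiset.toFinset_card_le _).trans ((card_roots' _).trans ?_))
  rw [twistDiff]
  compute_degree

/-- Candidates for the quadratic coefficient of a quartic with the other coefficients given by `y`
whose roots satisfy `z₀z₁ = ζz₂z₃` with `ζ ≠ 1` a root of unity of order dividing `M`. -/
noncomputable def quadCoeffOfPairs (M : ℕ) (y : Fin 4 → ℤ) : Finset ℂ :=
  (nthRootsFinset M (1 : ℂ)).biUnion fun ζ =>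
    (nthRootsFinset 2 (y 0 / (y 3 * ζ) : ℂ)).image fun q =>
      y 3 * (ζ * q + (-y 2 / y 3 - (-y 2 / y 3 + y 1 / (y 3 * q)) / (1 - ζ)) *
        ((-y 2 / y 3 + y 1 / (y 3 * q)) / (1 - ζ)) + q)

lemma card_quadCoeffOfPairs_le (M : ℕ) (y : Fin 4 → ℤ) :
    (quadCoeffOfPairs M y).card ≤ M * 2 := by
  refine (Finset.card_biUnion_le_card_mul _ _ 2 fun ζ _ => ?_).trans
    (Nat.mul_le_mul_right _ (card_nthRootsFinset_le M))
  refine Finset.card_image_le.trans ?_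
  classical
  rw [nthRootsFinset]
  exact (Multiset.toFinset_card_le _).trans (card_nthRoots 2 _)

/-- The coefficient vectors in a box that satisfy one of the conditions forced by a basic
multiplicative relation. -/
noncomputable def exceptionalBox (M : ℕ) (H : ℤ) : Finset (Fin 5 → ℤ) :=
  ((intBox 5 H).filter fun v => (v 0 : ℂ) ∈ constCoeffOfProd M (Fin.removeNth 0 v)) ∪
  ((intBox 5 H).filter fun v => (v 0 : ℂ) ∈ constCoeffOfRatio M (Fin.removeNth 0 v)) ∪
  ((intBox 5 H).filter fun v => (v 0 : ℂ) ∈ (fun y : Fin 4 → ℤ =>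
    ({(y 3 * y 0 ^ 2 / y 2 ^ 2 : ℂ)} : Finset ℂ)) (Fin.removeNth 0 v)) ∪
  ((intBox 5 H).filter fun v => (v 1 : ℂ) ∈ (fun _ : Fin 4 → ℤ =>
    ({0} : Finset ℂ)) (Fin.removeNth 1 v)) ∪
  ((intBox 5 H).filter fun v => (v 3 : ℂ) ∈ (fun _ : Fin 4 → ℤ =>
    ({0} : Finset ℂ)) (Fin.removeNth 3 v)) ∪
  ((intBox 5 H).filter fun v => (v 2 : ℂ) ∈ quadCoeffOfPairs M (Fin.removeNth 2 v))

lemma card_exceptionalBox_le (M : ℕ) (H : ℤ) :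
    (exceptionalBox M H).card ≤ (7 * M + 3) * (2 * H + 1).toNat ^ 4 := by
  have h1 := card_filter_intBox_le H 0 _ _ (card_constCoeffOfProd_le M)
  have h2 := card_filter_intBox_le H 0 _ _ (card_constCoeffOfRatio_le M)
  have h3 := card_filter_intBox_le H 0 1 (fun y : Fin 4 → ℤ =>
    ({(y 3 * y 0 ^ 2 / y 2 ^ 2 : ℂ)} : Finset ℂ)) fun _ => by simp
  have h4 := card_filter_intBox_le H 1 1 (fun _ : Fin 4 → ℤ => ({0} : Finset ℂ)) fun _ => by simp
  have h5 := card_filter_intBox_le H 3 1 (fun _ : Fin 4 → ℤ => ({0} : Finset ℂ)) fun _ => by simp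
  have h6 := card_filter_intBox_le H 2 _ _ (card_quadCoeffOfPairs_le M)
  refine (Finset.card_union_le _ _).trans ?_
  refine (Nat.add_le_add_right (Finset.card_union_le _ _) _).trans ?_
  refine (Nat.add_le_add_right (Nat.add_le_add_right (Finset.card_union_le _ _) _) _).trans ?_
  refine (Nat.add_le_add_right (Nat.add_le_add_right (Nat.add_le_add_right
    (Finset.card_union_le _ _) _) _) _).trans ?_
  refine (Nat.add_le_add_right (Nat.add_le_add_right (Nat.add_le_add_right (Nat.add_le_add_right
    (Finset.card_union_le _ _) _) _) _) _).trans ?_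
  linarith

/-- The first five coefficients of an integer polynomial. -/
def coeffVec (f : ℤ[X]) : Fin 5 → ℤ := fun i => f.coeff i

lemma coeffVec_injOn (H : ℤ) : Set.InjOn coeffVec (IstarSet 4 H) := by
  intro f hf g hg h
  ext i
  by_cases hi : i < 5
  · exact congrFun h ⟨i, hi⟩
  · rw [coeff_eq_zero_of_natDegree_lt (by rw [hf.1]; omega),
      coeff_eq_zero_of_natDegree_lt (by rw [hg.1]; omega)]

lemma coeffVec_mem_intBox {f : ℤ[X]} {H : ℤ} (h : HeightLe f H) : coeffVec f ∈ intBox 5 H :=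
  Fintype.mem_piFinset.2 fun i => Finset.mem_Icc.2 (abs_le.1 (h i))

lemma finite_IstarSet (H : ℤ) : (IstarSet 4 H).Finite :=
  Set.Finite.of_finite_image ((intBox 5 H).finite_toSet.subset (by
    rintro _ ⟨f, hf, rfl⟩
    exact coeffVec_mem_intBox hf.2.1)) (coeffVec_injOn H)

lemma coeffVec_mem_exceptionalBox {M : ℕ} (hM : 0 < M) {f : ℤ[X]} {H : ℤ} (hH : HeightLe f H)
    (h0 : f.coeff 0 ≠ 0) (h4 : f.coeff 4 ≠ 0)
    {a : ℂ} {z : Fin 4 → ℂ} (hz : Function.Injective z)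
    (hprod : f.map (Int.castRingHom ℂ) = C a * ∏ i, (X - C (z i)))
    (hrel : (z 0 * z 1 * z 2 * z 3) ^ M = 1 ∨ z 0 ^ M = z 1 ^ M ∨
      (z 0 * z 1) ^ M = (z 2 * z 3) ^ M) :
    coeffVec f ∈ exceptionalBox M H := by
  obtain ⟨e4, e3, e2, e1, e0⟩ := vieta_quartic hprod
  have ha : a ≠ 0 := by
    rw [← e4]
    exact_mod_cast h4
  have hprod0 : z 0 * z 1 * z 2 * z 3 ≠ 0 := by
    intro h
    rw [h, mul_zero] at e0
    exact h0 (by exact_mod_cast e0)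
  have hz0 : z 0 ≠ 0 := by rintro h; simp [h] at hprod0
  have hz1 : z 1 ≠ 0 := by rintro h; simp [h] at hprod0
  have hz2 : z 2 ≠ 0 := by rintro h; simp [h] at hprod0
  have hz3 : z 3 ≠ 0 := by rintro h; simp [h] at hprod0
  have c0 : ((coeffVec f 0 : ℤ) : ℂ) = f.coeff 0 := rfl
  have c1 : ((coeffVec f 1 : ℤ) : ℂ) = f.coeff 1 := rfl
  have c2 : ((coeffVec f 2 : ℤ) : ℂ) = f.coeff 2 := rfl
  have c3 : ((coeffVec f 3 : ℤ) : ℂ) = f.coeff 3 := rfl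
  have r00 : ((Fin.removeNth 0 (coeffVec f) : Fin 4 → ℤ) 0) = f.coeff 1 := rfl
  have r01 : ((Fin.removeNth 0 (coeffVec f) : Fin 4 → ℤ) 1) = f.coeff 2 := rfl
  have r02 : ((Fin.removeNth 0 (coeffVec f) : Fin 4 → ℤ) 2) = f.coeff 3 := rfl
  have r03 : ((Fin.removeNth 0 (coeffVec f) : Fin 4 → ℤ) 3) = f.coeff 4 := rfl
  have r20 : ((Fin.removeNth 2 (coeffVec f) : Fin 4 → ℤ) 0) = f.coeff 0 := rfl
  have r21 : ((Fin.removeNth 2 (coeffVec f) : Fin 4 → ℤ) 1) = f.coeff 1 := rfl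
  have r22 : ((Fin.removeNth 2 (coeffVec f) : Fin 4 → ℤ) 2) = f.coeff 3 := rfl
  have r23 : ((Fin.removeNth 2 (coeffVec f) : Fin 4 → ℤ) 3) = f.coeff 4 := rfl
  simp only [exceptionalBox, Finset.mem_union, Finset.mem_filter, coeffVec_mem_intBox hH, true_and]
  simp only [Finset.mem_singleton, constCoeffOfProd, constCoeffOfRatio, quadCoeffOfPairs,
    Finset.mem_biUnion, Finset.mem_image, c0, c1, c2, c3, r00, r01, r02, r03, r20, r21, r22, r23,
    mem_nthRootsFinset hM, mem_nthRootsFinset (zero_lt_two : 0 < 2), Multiset.mem_toFinset]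
  rcases hrel with h | h | h
  · iterate 5 left
    exact ⟨_, h, by rw [e4, e0]⟩
  · by_cases hd : (f.coeff 1 : ℂ) = 0
    · left; left; right
      exact hd
    iterate 4 left
    right
    have hne : (1 : ℂ) - z 1 / z 0 ≠ 0 := by
      rw [sub_ne_zero]
      intro h'
      rw [eq_comm, div_eq_one_iff_eq hz0] at h'
      exact absurd (hz h') (by decide)
    have hT : twistDiff (Fin.removeNth 0 (coeffVec f) : Fin 4 → ℤ) (z 1 / z 0) ≠ 0 := by
      intro h'
      have := congrArg (fun q : ℂ[X] => q.coeff 1) h'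
      simp only [twistDiff, r00] at this
      simp [coeff_X_pow, -map_mul, -map_sub, hd, hne] at this
    refine ⟨z 1 / z 0, by rw [div_pow, h, div_self (pow_ne_zero _ hz1)], z 0, ?_, ?_⟩
    · rw [mem_roots hT, IsRoot.def, twistDiff, r00, r01, r02, r03]
      simp only [eval_add, eval_mul, eval_C, eval_pow, eval_X]
      rw [e1, e2, e3, e4]
      field_simp
      ring
    · rw [e0, e1, e2, e3, e4]
      ring
  · set ζ := z 0 * z 1 / (z 2 * z 3) with hζ
    have hζM : ζ ^ M = 1 := by
      rw [hζ, div_pow, h, div_self (pow_ne_zero _ (mul_ne_zero hz2 hz3))]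
    have hζ0 : ζ ≠ 0 := div_ne_zero (mul_ne_zero hz0 hz1) (mul_ne_zero hz2 hz3)
    have hp : z 0 * z 1 = ζ * (z 2 * z 3) := by
      rw [hζ]
      field_simp
    by_cases hb : (f.coeff 3 : ℂ) = 0
    · left; right
      exact hb
    by_cases h1 : ζ = 1
    · left; left; left; right
      rw [h1, one_mul] at hp
      rw [eq_div_iff (pow_ne_zero 2 hb), e0, e1, e3, e4, mul_assoc _ (z 2) (z 3), hp]
      ring
    · right
      have h1' : 1 - ζ ≠ 0 := sub_ne_zero.2 (Ne.symm h1)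
      refine ⟨ζ, hζM, z 2 * z 3, ?_, ?_⟩
      · rw [e0, e4, mul_assoc _ (z 2) (z 3), hp]
        field_simp
      · have ht : (-(f.coeff 3 : ℂ) / f.coeff 4 + f.coeff 1 / (f.coeff 4 * (z 2 * z 3))) / (1 - ζ)
            = z 2 + z 3 := by
          rw [div_eq_iff h1', e1, e3, e4, hp]
          field_simp
          ring
        rw [ht, e2, e3, e4, hp]
        field_simp
        ring

lemma exists_card_IstarSet_le :
    ∃ N : ℕ, ∀ H : ℤ, (IstarSet 4 H).ncard ≤ N * (2 * H + 1).toNat ^ 4 := by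
  obtain ⟨M, hM, h⟩ := exists_root_relation
  refine ⟨7 * M + 3, fun H => le_trans ?_ (card_exceptionalBox_le M H)⟩
  rw [← Set.ncard_coe_finset]
  refine Set.ncard_le_ncard_of_injOn coeffVec ?_ (coeffVec_injOn H) (Finset.finite_toSet _)
  rintro f ⟨hd, hH, hf, -, hdep⟩
  obtain ⟨z, hz, hprod, hrel⟩ := h f hd hf hdep
  have hlc : f.coeff 4 ≠ 0 := by
    rw [← hd]
    exact leadingCoeff_ne_zero.2 hf.ne_zero
  exact coeffVec_mem_exceptionalBox hM hH (coeff_zero_ne_zero_of_irreducible hf (by omega)) hlc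
    hz hprod hrel

lemma sum_inv_sq_Icc_two_le {n : ℕ} (hn : 2 ≤ n) :
    ∑ g ∈ Finset.Icc 2 n, ((g : ℝ) ^ 2)⁻¹ ≤ 3 / 4 - (n : ℝ)⁻¹ := by
  induction n, hn using Nat.le_induction with
  | base => norm_num
  | succ n hn ih =>
    rw [Finset.sum_Icc_succ_top (by omega)]
    have hn0 : (0 : ℝ) < n := by exact_mod_cast (by omega : 0 < n)
    have key : (((n + 1 : ℕ) : ℝ) ^ 2)⁻¹ ≤ (n : ℝ)⁻¹ - ((n + 1 : ℕ) : ℝ)⁻¹ := by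
      push_cast
      rw [inv_sub_inv hn0.ne' (by positivity), inv_eq_one_div,
        div_le_div_iff₀ (by positivity) (by positivity)]
      nlinarith
    linarith

/-- The pairs of coprime integers in `[1, N]`. -/
def coprimePairs (N : ℕ) : Finset (ℕ × ℕ) :=
  {p ∈ Finset.Icc 1 N ×ˢ Finset.Icc 1 N | p.1.Coprime p.2}

lemma sq_le_four_mul_card_coprimePairs (N : ℕ) : N ^ 2 ≤ 4 * (coprimePairs N).card := by
  rcases lt_or_ge N 2 with hN | hN
  · interval_cases N <;> decide
  have hsub : {p ∈ Finset.Icc 1 N ×ˢ Finset.Icc 1 N | ¬ p.1.Coprime p.2} ⊆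
      (Finset.Icc 2 N).biUnion fun g =>
        (Finset.Icc 1 (N / g) ×ˢ Finset.Icc 1 (N / g)).image fun p => (g * p.1, g * p.2) := by
    rintro ⟨x, y⟩ h
    simp only [Finset.mem_filter, Finset.mem_product, Finset.mem_Icc] at h
    obtain ⟨⟨⟨hx1, hxN⟩, hy1, hyN⟩, hxy⟩ := h
    have hg0 : 0 < x.gcd y := Nat.gcd_pos_of_pos_left _ hx1
    have hgx : x.gcd y ≤ x := Nat.gcd_le_left _ hx1
    have hgy : x.gcd y ≤ y := Nat.gcd_le_right _ hy1
    simp only [Finset.mem_biUnion, Finset.mem_image, Finset.mem_product, Finset.mem_Icc,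
      Prod.exists, Prod.mk.injEq]
    refine ⟨x.gcd y, ⟨?_, hgx.trans hxN⟩, x / x.gcd y, y / x.gcd y,
      ⟨⟨Nat.div_pos hgx hg0, Nat.div_le_div_right hxN⟩, Nat.div_pos hgy hg0,
        Nat.div_le_div_right hyN⟩,
      Nat.mul_div_cancel' (Nat.gcd_dvd_left x y), Nat.mul_div_cancel' (Nat.gcd_dvd_right x y)⟩
    rw [Nat.Coprime] at hxy
    omega
  have hcard : ({p ∈ Finset.Icc 1 N ×ˢ Finset.Icc 1 N | ¬ p.1.Coprime p.2}.card : ℝ) ≤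
      3 / 4 * (N : ℝ) ^ 2 := by
    have h1 : {p ∈ Finset.Icc 1 N ×ˢ Finset.Icc 1 N | ¬ p.1.Coprime p.2}.card ≤
        ∑ g ∈ Finset.Icc 2 N, (N / g) ^ 2 := by
      refine (Finset.card_le_card hsub).trans (Finset.card_biUnion_le.trans ?_)
      refine Finset.sum_le_sum fun g _ => Finset.card_image_le.trans ?_
      simp [sq]
    calc _ ≤ ((∑ g ∈ Finset.Icc 2 N, (N / g) ^ 2 : ℕ) : ℝ) := by exact_mod_cast h1
      _ = ∑ g ∈ Finset.Icc 2 N, ((N / g : ℕ) : ℝ) ^ 2 := by push_cast; rfl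
      _ ≤ ∑ g ∈ Finset.Icc 2 N, ((g : ℝ) ^ 2)⁻¹ * (N : ℝ) ^ 2 := by
        refine Finset.sum_le_sum fun g _ => ?_
        calc ((N / g : ℕ) : ℝ) ^ 2 ≤ ((N : ℝ) / g) ^ 2 := by
              gcongr
              exact Nat.cast_div_le
          _ = _ := by rw [div_pow, div_eq_inv_mul]
      _ ≤ 3 / 4 * (N : ℝ) ^ 2 := by
        rw [← Finset.sum_mul]
        gcongr
        have : (0 : ℝ) ≤ (N : ℝ)⁻¹ := by positivity
        linarith [sum_inv_sq_Icc_two_le hN]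
  have htot := Finset.card_filter_add_card_filter_not (s := Finset.Icc 1 N ×ˢ Finset.Icc 1 N)
    (fun p : ℕ × ℕ => p.1.Coprime p.2)
  rw [Finset.card_product, Nat.card_Icc, Nat.add_sub_cancel] at htot
  have htot' : ((coprimePairs N).card : ℝ) +
      ({p ∈ Finset.Icc 1 N ×ˢ Finset.Icc 1 N | ¬ p.1.Coprime p.2}.card : ℝ) = (N : ℝ) * N := by
    exact_mod_cast htot
  have : (N : ℝ) ^ 2 ≤ 4 * ((coprimePairs N).card : ℝ) := by nlinarith
  exact_mod_cast this

lemma irreducible_X_pow_four_add_X_add_one : Irreducible (X ^ 4 + X + 1 : (ZMod 2)[X]) := by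
  have hdeg : (X ^ 4 + X + 1 : (ZMod 2)[X]).natDegree = 4 := by compute_degree!
  have hm : (X ^ 4 + X + 1 : (ZMod 2)[X]).Monic := by monicity!
  rw [hm.irreducible_iff_natDegree']
  refine ⟨fun h => by simp [h] at hdeg, fun f g hf hg h hmem => ?_⟩
  have hsum : f.natDegree + g.natDegree = 4 := by rw [← hf.natDegree_mul hg, h, hdeg]
  rw [hdeg, Finset.mem_Ioc] at hmem
  have c0 := congrArg (fun q => coeff q 0) h
  have c1 := congrArg (fun q => coeff q 1) h
  have c2 := congrArg (fun q => coeff q 2) h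
  have c3 := congrArg (fun q => coeff q 3) h
  simp [coeff_mul, Finset.Nat.antidiagonal_succ, coeff_X, coeff_one] at c0 c1 c2 c3
  have hf1 := hf.coeff_natDegree
  have hg1 := hg.coeff_natDegree
  obtain hg' | hg' : g.natDegree = 1 ∨ g.natDegree = 2 := by omega
  · have hf' : f.natDegree = 3 := by omega
    have g2 : g.coeff 2 = 0 := coeff_eq_zero_of_natDegree_lt (by omega)
    have g3 : g.coeff 3 = 0 := coeff_eq_zero_of_natDegree_lt (by omega)
    rw [hf'] at hf1
    rw [hg'] at hg1
    rw [hf1, g2, g3, hg1] at c3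
    rw [g2, hg1] at c2
    rw [hg1] at c1
    generalize f.coeff 0 = f0, f.coeff 1 = f1, f.coeff 2 = f2, g.coeff 0 = g0 at *
    clear * - c0 c1 c2 c3
    revert f0 f1 f2 g0
    decide
  · have hf' : f.natDegree = 2 := by omega
    have g3 : g.coeff 3 = 0 := coeff_eq_zero_of_natDegree_lt (by omega)
    have f3 : f.coeff 3 = 0 := coeff_eq_zero_of_natDegree_lt (by omega)
    rw [hf'] at hf1
    rw [hg'] at hg1
    rw [hf1, g3, f3, hg1] at c3
    rw [hf1, hg1] at c2
    generalize f.coeff 0 = f0, f.coeff 1 = f1, g.coeff 0 = g0, g.coeff 1 = g1 at *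
    clear * - c0 c1 c2 c3
    revert f0 f1 g0 g1
    decide

lemma irreducible_of_isPrimitive_of_irreducible_map {R K : Type*} [CommRing R] [IsDomain R]
    [Field K] (φ : R →+* K) {f : R[X]} (hf : f.IsPrimitive) (hlc : φ f.leadingCoeff ≠ 0)
    (h : Irreducible (f.map φ)) : Irreducible f := by
  have key : ∀ a b : R[X], f = a * b → IsUnit (a.map φ) → IsUnit a := by
    intro a b hab ha
    have hla : φ a.leadingCoeff ≠ 0 := by
      rw [hab, leadingCoeff_mul, map_mul] at hlc
      exact left_ne_zero_of_mul hlc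
    have hd : a.natDegree = 0 := by
      rw [← natDegree_map_of_leadingCoeff_ne_zero φ hla]
      exact natDegree_eq_zero_of_isUnit ha
    rw [eq_C_of_natDegree_eq_zero hd] at hab ⊢
    exact (hf _ ⟨b, hab⟩).map C
  refine ⟨fun hu => h.not_isUnit (hu.map (mapRingHom φ)), fun a b hab => ?_⟩
  have := h.isUnit_or_isUnit (a := a.map φ) (b := b.map φ) (by rw [hab, Polynomial.map_mul])
  exact this.imp (key a b hab) (key b a (hab.trans (mul_comm a b)))

lemma genDeg_of_coeff_zero_eq_leadingCoeff {f : ℤ[X]} (hf : Irreducible f) (hd : f.natDegree = 4)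
    (h : f.coeff 0 = f.leadingCoeff) : GenDeg f := by
  set g : ℂ[X] := f.map (Int.castRingHom ℂ) with hg
  have hinj : Function.Injective (Int.castRingHom ℂ) := (Int.castRingHom ℂ).injective_int
  have hgd : g.natDegree = 4 := by rw [hg, natDegree_map_eq_of_injective hinj, hd]
  have hg0 : g ≠ 0 := by
    rintro h0
    simp [h0] at hgd
  have hnodup : g.roots.Nodup := by
    refine nodup_roots ?_
    have := ((irreducible_map_rat hf (by omega)).separable).map (f := algebraMap ℚ ℂ)
    rwa [Polynomial.map_map, Subsingleton.elim ((algebraMap ℚ ℂ).comp (Int.castRingHom ℚ))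
      (Int.castRingHom ℂ)] at this
  have hsplit : g.Splits := IsAlgClosed.splits g
  have hc : g.coeff 0 = g.leadingCoeff := by
    rw [hg, coeff_map, h, leadingCoeff_map_of_injective hinj]
  have hprod : g.roots.prod = 1 := by
    have := hsplit.coeff_zero_eq_leadingCoeff_mul_prod_roots
    rw [hgd, hc] at this
    refine mul_left_cancel₀ (leadingCoeff_ne_zero.2 hg0) ?_
    linear_combination -this
  have hne : ∀ z ∈ g.roots.toFinset, z ≠ 0 := by
    rintro z hz rfl
    rw [Multiset.mem_toFinset] at hz
    exact one_ne_zero (hprod.symm.trans (Multiset.prod_eq_zero hz))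
  have hnz : nzRoots f = g.roots.toFinset := Finset.filter_true_of_mem hne
  refine ⟨by omega, fun _ => 1, ?_, ?_⟩
  · rw [hnz]
    obtain ⟨z, hz⟩ := Multiset.exists_mem_of_ne_zero (s := g.roots) (by
      intro h0
      have := hsplit.natDegree_eq_card_roots
      simp [h0, hgd] at this)
    exact ⟨z, Multiset.mem_toFinset.2 hz, one_ne_zero⟩
  · rw [hnz]
    simp only [zpow_one]
    rw [Finset.prod_eq_multiset_prod, Multiset.toFinset_val, hnodup.dedup, Multiset.map_id', hprod]

/-- The quartic polynomial with leading and constant coefficient `2 a + 1`, linear coefficient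
`2 d + 1` and remaining coefficients `2 b`, `2 c`. -/
noncomputable def oddEvenQuartic (v : (ℕ × ℕ) × (ℕ × ℕ)) : ℤ[X] :=
  C (2 * v.1.1 + 1 : ℤ) * X ^ 4 + C (2 * v.2.1 : ℤ) * X ^ 3 + C (2 * v.2.2 : ℤ) * X ^ 2 +
    C (2 * v.1.2 + 1 : ℤ) * X + C (2 * v.1.1 + 1 : ℤ)

lemma coeff_oddEvenQuartic (v : (ℕ × ℕ) × (ℕ × ℕ)) (i : ℕ) :
    (oddEvenQuartic v).coeff i = if i = 4 then 2 * (v.1.1 : ℤ) + 1 else if i = 3 then 2 * v.2.1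
      else if i = 2 then 2 * v.2.2 else if i = 1 then 2 * v.1.2 + 1
      else if i = 0 then 2 * v.1.1 + 1 else 0 := by
  simp only [oddEvenQuartic, coeff_add, coeff_C_mul, coeff_X_pow, coeff_X, coeff_C]
  rcases i with _ | _ | _ | _ | _ | i <;> simp

lemma natDegree_oddEvenQuartic (v : (ℕ × ℕ) × (ℕ × ℕ)) : (oddEvenQuartic v).natDegree = 4 := by
  rw [oddEvenQuartic]
  compute_degree!

lemma oddEvenQuartic_injective : Function.Injective oddEvenQuartic := by
  rintro ⟨⟨a, d⟩, b, c⟩ ⟨⟨a', d'⟩, b', c'⟩ h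
  have h4 := congrArg (fun q => coeff q 4) h
  have h3 := congrArg (fun q => coeff q 3) h
  have h2 := congrArg (fun q => coeff q 2) h
  have h1 := congrArg (fun q => coeff q 1) h
  simp [coeff_oddEvenQuartic] at h1 h2 h3 h4
  simp [h1, h2, h3, h4]

lemma irreducible_oddEvenQuartic {v : (ℕ × ℕ) × (ℕ × ℕ)} (h : v.2.1.Coprime v.2.2) :
    Irreducible (oddEvenQuartic v) := by
  refine irreducible_of_isPrimitive_of_irreducible_map (Int.castRingHom (ZMod 2)) ?_ ?_ ?_
  · intro r hr
    rw [C_dvd_iff_dvd_coeff] at hr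
    have h4 := hr 4
    have h3 := hr 3
    have h2 := hr 2
    simp only [coeff_oddEvenQuartic] at h2 h3 h4
    norm_num at h2 h3 h4
    have hco : IsCoprime r 2 := by
      refine IsCoprime.of_isCoprime_of_dvd_left ?_ h4
      exact ⟨1, -v.1.1, by ring⟩
    exact (Nat.isCoprime_iff_coprime.2 h).isUnit_of_dvd' (hco.dvd_of_dvd_mul_left h3)
      (hco.dvd_of_dvd_mul_left h2)
  · rw [leadingCoeff, natDegree_oddEvenQuartic, coeff_oddEvenQuartic]
    have : (2 : ZMod 2) = 0 := rfl
    simp [this]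
  · have : (2 : ZMod 2) = 0 := rfl
    have h2 : (oddEvenQuartic v).map (Int.castRingHom (ZMod 2)) = X ^ 4 + X + 1 := by
      have h2' : (2 : (ZMod 2)[X]) = 0 := by
        rw [← C_ofNat, this, C_0]
      simp [oddEvenQuartic, h2']
    rw [h2]
    exact irreducible_X_pow_four_add_X_add_one

lemma oddEvenQuartic_mem_IstarSet {v : (ℕ × ℕ) × (ℕ × ℕ)} {N : ℕ} {H : ℤ} (hN : 2 * (N : ℤ) ≤ H)
    (h1 : v.1.1 < N) (h2 : v.1.2 < N) (h3 : v.2.1 ≤ N) (h4 : v.2.2 ≤ N)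
    (h : v.2.1.Coprime v.2.2) : oddEvenQuartic v ∈ IstarSet 4 H := by
  have hirr := irreducible_oddEvenQuartic h
  refine ⟨natDegree_oddEvenQuartic v, fun i => ?_, hirr,
    genDeg_of_coeff_zero_eq_leadingCoeff hirr (natDegree_oddEvenQuartic v) ?_⟩
  · rw [coeff_oddEvenQuartic, abs_le]
    split_ifs <;> omega
  · rw [leadingCoeff, natDegree_oddEvenQuartic]
    simp [coeff_oddEvenQuartic]

lemma pow_four_le_card_IstarSet {N : ℕ} {H : ℤ} (hN : 2 * (N : ℤ) ≤ H) :
    N ^ 4 ≤ 4 * (IstarSet 4 H).ncard := by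
  set F := (Finset.range N ×ˢ Finset.range N) ×ˢ coprimePairs N with hF
  have hle : F.card ≤ (IstarSet 4 H).ncard := by
    rw [← Set.ncard_coe_finset]
    refine Set.ncard_le_ncard_of_injOn oddEvenQuartic ?_ oddEvenQuartic_injective.injOn
      (finite_IstarSet H)
    intro v hv
    simp only [hF, coprimePairs, Finset.mem_coe, Finset.mem_product, Finset.mem_range,
      Finset.mem_filter, Finset.mem_Icc] at hv
    exact oddEvenQuartic_mem_IstarSet hN hv.1.1 hv.1.2 hv.2.1.1.2 hv.2.1.2.2 hv.2.2
  have hcard : F.card = N ^ 2 * (coprimePairs N).card := by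
    rw [hF, Finset.card_product, Finset.card_product, Finset.card_range, sq]
  calc N ^ 4 = N ^ 2 * N ^ 2 := by ring
    _ ≤ N ^ 2 * (4 * (coprimePairs N).card) :=
      Nat.mul_le_mul_left _ (sq_le_four_mul_card_coprimePairs N)
    _ = 4 * F.card := by rw [hcard]; ring
    _ ≤ 4 * (IstarSet 4 H).ncard := Nat.mul_le_mul_left _ hle

theorem stmt_12 :
    ∃ c1 c2 : ℝ, 0 < c1 ∧ 0 < c2 ∧ ∀ H : ℤ, 3 ≤ H →
      c1 * (H : ℝ) ^ 4 ≤ ((IstarSet 4 H).ncard : ℝ) ∧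
      ((IstarSet 4 H).ncard : ℝ) ≤ c2 * (H : ℝ) ^ 4 := by
  obtain ⟨M, hM⟩ := exists_card_IstarSet_le
  refine ⟨1 / 324, 81 * (M + 1), by norm_num, by positivity, fun H hH => ⟨?_, ?_⟩⟩
  · have h := pow_four_le_card_IstarSet (N := (H / 2).toNat) (H := H) (by omega)
    have hN : (H : ℝ) ≤ 3 * ((H / 2).toNat : ℝ) := by
      exact_mod_cast (by omega : H ≤ 3 * ((H / 2).toNat : ℤ))
    have hH0 : (0 : ℝ) ≤ H := by exact_mod_cast (by omega : 0 ≤ H)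
    have h' : ((H / 2).toNat : ℝ) ^ 4 ≤ 4 * ((IstarSet 4 H).ncard : ℝ) := by exact_mod_cast h
    have := pow_le_pow_left₀ hH0 hN 4
    rw [mul_pow] at this
    linarith
  · have hH0 : (0 : ℝ) ≤ H := by exact_mod_cast (by omega : 0 ≤ H)
    have hle : (((2 * H + 1).toNat : ℕ) : ℝ) ≤ 3 * H := by
      exact_mod_cast (by omega : ((2 * H + 1).toNat : ℤ) ≤ 3 * H)
    calc ((IstarSet 4 H).ncard : ℝ) ≤ M * ((2 * H + 1).toNat : ℝ) ^ 4 := by exact_mod_cast hM H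
      _ ≤ (M + 1) * (3 * H : ℝ) ^ 4 := by
        gcongr
        linarith
      _ = 81 * (M + 1) * (H : ℝ) ^ 4 := by ring
end

section
/- There exists a constant C > 0 such that for every integer H ≥ 3, |#M*_2(H) − 18H²| ≤ C·H·log H, where #M*_2(H) is the number of generalized degenerate integer polynomials (not necessarily monic) of degree 2 and height at most H. -/
open Polynomial MeasureTheory

/-- The integer polynomial `a X² + b X + c`. -/
noncomputable def quad (a b c : ℤ) : ℤ[X] := C a * X ^ 2 + C b * X + C c

lemma mem_nzRoots_quad {a b c : ℤ} (ha : a ≠ 0) (z : ℂ) :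
    z ∈ nzRoots (quad a b c) ↔ (a : ℂ) * z ^ 2 + b * z + c = 0 ∧ z ≠ 0 := by
  have hne : (quad a b c).map (Int.castRingHom ℂ) ≠ 0 := by
    rw [Polynomial.map_ne_zero_iff (Int.castRingHom ℂ).injective_int]
    intro h
    have : (quad a b c).natDegree = 2 := natDegree_quadratic ha
    simp [h] at this
  simp only [nzRoots, Finset.mem_filter, Multiset.mem_toFinset, mem_roots hne, IsRoot.def]
  simp [quad]

lemma exists_roots_quadratic {a : ℂ} (ha : a ≠ 0) (b c : ℂ) :
    ∃ α β : ℂ, a * (α + β) = -b ∧ a * (α * β) = c ∧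
      ∀ z, a * z ^ 2 + b * z + c = 0 ↔ z = α ∨ z = β := by
  obtain ⟨δ, hδ⟩ := IsAlgClosed.exists_pow_nat_eq (b ^ 2 - 4 * a * c) (n := 2) (by norm_num)
  have h1 : a * ((-b + δ) / (2 * a) + (-b - δ) / (2 * a)) = -b := by field_simp; ring
  have h2 : a * ((-b + δ) / (2 * a) * ((-b - δ) / (2 * a))) = c := by
    field_simp; linear_combination -hδ
  refine ⟨(-b + δ) / (2 * a), (-b - δ) / (2 * a), h1, h2, fun z => ?_⟩
  generalize (-b + δ) / (2 * a) = α at *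
  generalize (-b - δ) / (2 * a) = β at *
  have : a * z ^ 2 + b * z + c = a * ((z - α) * (z - β)) := by
    linear_combination z * h1 - h2
  rw [this, mul_eq_zero, mul_eq_zero, sub_eq_zero, sub_eq_zero]
  simp [ha]

lemma nzRoots_quad_eq {a b c : ℤ} (ha : a ≠ 0) (hc : c ≠ 0) :
    ∃ α β : ℂ, a * (α + β) = -b ∧ a * (α * β) = c ∧ α ≠ 0 ∧ β ≠ 0 ∧
      nzRoots (quad a b c) = {α, β} := by
  obtain ⟨α, β, h1, h2, h3⟩ := exists_roots_quadratic (Int.cast_ne_zero.2 ha) (b : ℂ) (c : ℂ)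
  have hc' : (c : ℂ) ≠ 0 := Int.cast_ne_zero.2 hc
  have hα : α ≠ 0 := by rintro rfl; simp at h2; exact hc' h2.symm
  have hβ : β ≠ 0 := by rintro rfl; simp at h2; exact hc' h2.symm
  refine ⟨α, β, h1, h2, hα, hβ, ?_⟩
  ext z
  rw [mem_nzRoots_quad ha, h3, Finset.mem_insert, Finset.mem_singleton]
  constructor
  · exact fun h => h.1
  · rintro (rfl | rfl) <;> simp [*]

lemma mulDep_of_one_mem {S : Finset ℂ} (h : (1 : ℂ) ∈ S) : MulDep S := by
  classical
  refine ⟨fun z => if z = 1 then 1 else 0, ⟨1, h, by simp⟩, Finset.prod_eq_one fun z _ => ?_⟩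
  dsimp only
  split_ifs with hz <;> simp [hz]

lemma mulDep_of_neg_one_mem {S : Finset ℂ} (h : (-1 : ℂ) ∈ S) : MulDep S := by
  classical
  refine ⟨fun z => if z = -1 then 2 else 0, ⟨-1, h, by simp⟩, Finset.prod_eq_one fun z _ => ?_⟩
  dsimp only
  split_ifs with hz
  · subst hz; norm_num
  · simp

lemma mulDep_quad_of_eq_or_neg {a b c : ℤ} (ha : a ≠ 0) (h : c = a ∨ c = -a) :
    MulDep (nzRoots (quad a b c)) := by
  have hc : c ≠ 0 := by omega
  obtain ⟨α, β, -, h2, hα, hβ, hS⟩ := nzRoots_quad_eq (b := b) ha hc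
  have ha' : (a : ℂ) ≠ 0 := Int.cast_ne_zero.2 ha
  have h4 : (α * β) ^ 2 = 1 := by
    have : (α * β) = 1 ∨ (α * β) = -1 := by
      rcases h with rfl | rfl
      · left; exact mul_left_cancel₀ ha' (by simpa using h2)
      · right; exact mul_left_cancel₀ ha' (by simpa using h2)
    rcases this with h | h <;> simp [h]
  rw [hS]
  refine ⟨fun _ => 4, ⟨α, by simp, by norm_num⟩, ?_⟩
  by_cases hab : α = β
  · subst hab
    simp only [Finset.pair_eq_singleton, Finset.prod_singleton]
    rw [← h4]; norm_cast; ring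
  · rw [Finset.prod_pair hab, ← mul_zpow]
    calc (α * β) ^ (4 : ℤ) = ((α * β) ^ 2) ^ 2 := by norm_cast; ring
      _ = 1 := by rw [h4]; simp

lemma mulDep_quad_of_middle_eq_zero {a c : ℤ} (ha : a ≠ 0) (hc : c ≠ 0) :
    MulDep (nzRoots (quad a 0 c)) := by
  classical
  obtain ⟨α, β, h1, h2, hα, hβ, hS⟩ := nzRoots_quad_eq (b := 0) ha hc
  have ha' : (a : ℂ) ≠ 0 := Int.cast_ne_zero.2 ha
  have hs : β = -α := by
    have : α + β = 0 := by simpa [ha'] using h1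
    linear_combination this
  have hab : α ≠ β := by
    rw [hs]; intro h; exact hα (by linear_combination h / 2)
  rw [hS]
  refine ⟨fun z => if z = α then 2 else -2, ⟨α, by simp, by simp⟩, ?_⟩
  simp only [Finset.prod_pair hab, if_true, if_neg hab.symm]
  rw [hs]
  simp [zpow_neg]
  norm_cast
  field_simp

lemma rat_eq_one_or_neg_one_of_zpow {x : ℚ} {k : ℤ} (hk : k ≠ 0) (h : x ^ k = 1) :
    x = 1 ∨ x = -1 := by
  have h1 : |x| ^ k = 1 := by rw [← abs_zpow, h, abs_one]
  have h2 : |x| = 1 := (zpow_left_inj₀ (abs_nonneg _) zero_le_one hk).1 (by rw [h1, one_zpow])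
  exact eq_or_eq_neg_of_abs_eq h2

/-- The powers of the two roots of a rational quadratic have the same coordinates. -/
lemma exists_pow_eq_linear {α β : ℂ} {s p : ℚ} (hs : α + β = s) (hp : α * β = p) (n : ℕ) :
    ∃ x y : ℚ, α ^ n = x * α + y ∧ β ^ n = x * β + y := by
  induction n with
  | zero => exact ⟨0, 1, by simp, by simp⟩
  | succ n ih =>
    obtain ⟨x, y, h1, h2⟩ := ih
    refine ⟨x * s + y, -(x * p), ?_, ?_⟩
    · rw [pow_succ, h1]; push_cast; rw [← hs, ← hp]; ring
    · rw [pow_succ, h2]; push_cast; rw [← hs, ← hp]; ring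

lemma pow_eq_pow_of_rat_pow {α β : ℂ} {s p ρ : ℚ} {n : ℕ} (hs : α + β = s) (hp : α * β = p)
    (hα : ∀ q : ℚ, α ≠ q) (h : α ^ n = ρ) : α ^ n = β ^ n := by
  obtain ⟨x, y, h1, h2⟩ := exists_pow_eq_linear hs hp n
  by_cases hx : x = 0
  · rw [h1, h2, hx]; simp
  · exfalso
    apply hα ((ρ - y) / x)
    have hx' : (x : ℂ) ≠ 0 := by exact_mod_cast hx
    push_cast
    rw [eq_div_iff hx', ← h, h1]; ring

/-- A rational number of the form `ζ + ζ⁻¹`, with `ζ` a root of unity, is an integer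
in `[-2, 2]`. -/
lemma exists_int_of_add_inv_eq_rat {ζ : ℂ} {n : ℕ} {q : ℚ} (hn : n ≠ 0) (h : ζ ^ n = 1)
    (hq : ζ + ζ⁻¹ = q) : ∃ j : ℤ, q = j ∧ |j| ≤ 2 := by
  have i1 : ∀ z : ℂ, z ^ n = 1 → IsIntegral ℤ z := fun z hz =>
    IsIntegral.of_pow (Nat.pos_of_ne_zero hn) (by rw [hz]; exact isIntegral_one)
  have h' : ζ⁻¹ ^ n = 1 := by rw [inv_pow, h, inv_one]
  have i2 : IsIntegral ℤ ((algebraMap ℚ ℂ) q) := by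
    have : (algebraMap ℚ ℂ) q = ζ + ζ⁻¹ := by rw [hq]; simp
    rw [this]; exact (i1 _ h).add (i1 _ h')
  have i3 : IsIntegral ℤ q := (isIntegral_algebraMap_iff (algebraMap ℚ ℂ).injective).1 i2
  obtain ⟨j, hj⟩ := IsIntegrallyClosed.isIntegral_iff.1 i3
  refine ⟨j, by simpa using hj.symm, ?_⟩
  have n1 : ‖ζ‖ = 1 := Complex.norm_eq_one_of_pow_eq_one h hn
  have n2 : ‖ζ⁻¹‖ = 1 := Complex.norm_eq_one_of_pow_eq_one h' hn
  have n3 : ‖(j : ℂ)‖ ≤ 2 := by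
    have : (j : ℂ) = ζ + ζ⁻¹ := by rw [hq, ← hj]; simp
    rw [this]
    calc _ ≤ ‖ζ‖ + ‖ζ⁻¹‖ := norm_add_le _ _
      _ = 2 := by rw [n1, n2]; norm_num
  rw [Complex.norm_intCast] at n3
  exact_mod_cast n3

lemma exists_rat_base {α β : ℚ} (hα : α ≠ 0) (hβ : β ≠ 0) {k l : ℤ} (hk : k ≠ 0) (hl : l ≠ 0)
    (h : α ^ k * β ^ l = 1) :
    ∃ (γ : ℚ) (m n : ℤ), 0 < γ ∧ m ≠ 0 ∧ n ≠ 0 ∧ |α| = γ ^ m ∧ |β| = γ ^ n := by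
  have hA : 0 < |α| := abs_pos.2 hα
  have hB : 0 < |β| := abs_pos.2 hβ
  have h1 : |α| ^ k * |β| ^ l = 1 := by rw [← abs_zpow, ← abs_zpow, ← abs_mul, h, abs_one]
  generalize |α| = A at *
  generalize |β| = B at *
  have hg : 0 < Int.gcd k l := Int.gcd_pos_of_ne_zero_left _ hk
  obtain ⟨g, k', l', hg', hcop, rfl, rfl⟩ :
      ∃ (g : ℕ) (k' l' : ℤ), 0 < g ∧ IsCoprime k' l' ∧ k = k' * g ∧ l = l' * g := by
    obtain ⟨k', l', hc, e1, e2⟩ := Int.exists_gcd_one hg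
    exact ⟨Int.gcd k l, k', l', hg, Int.isCoprime_iff_gcd_eq_one.2 hc, e1, e2⟩
  have hk' : k' ≠ 0 := left_ne_zero_of_mul hk
  have hl' : l' ≠ 0 := left_ne_zero_of_mul hl
  have h2 : A ^ k' * B ^ l' = 1 := by
    rw [zpow_mul, zpow_mul, ← mul_zpow] at h1
    exact (zpow_left_inj₀ (by positivity) zero_le_one (Int.natCast_ne_zero.2 hg'.ne')).1 (by rw [h1, one_zpow])
  obtain ⟨x, y, hxy⟩ := hcop
  have h3 : A ^ k' = B ^ (-l') := by rw [zpow_neg]; exact eq_inv_of_mul_eq_one_left h2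
  refine ⟨A ^ y * B ^ (-x), l', -k', by positivity, hl', neg_ne_zero.2 hk', ?_, ?_⟩
  · rw [mul_zpow, ← zpow_mul, ← zpow_mul]
    have : B ^ (-x * l') = A ^ (k' * x) := by rw [zpow_mul A, h3, ← zpow_mul]; ring_nf
    rw [this, ← zpow_add₀ hA.ne', show y * l' + k' * x = 1 by linarith, zpow_one]
  · rw [mul_zpow, ← zpow_mul, ← zpow_mul]
    have : A ^ (y * -k') = B ^ (l' * y) := by
      rw [show y * -k' = k' * (-y) by ring, zpow_mul A, h3, ← zpow_mul]; ring_nf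
    rw [this, ← zpow_add₀ hB.ne', show l' * y + -x * -k' = 1 by linarith, zpow_one]

/-- `a X² + b X + c` splits over `ℚ` with roots `α`, `β`. -/
lemma exists_rat_factorization {a b c : ℤ} {α β : ℚ} (ha : a ≠ 0) (h1 : a * (α + β) = -b)
    (h2 : a * (α * β) = c) :
    ∃ t : ℤ, t ≠ 0 ∧ a = t * (α.den * β.den) ∧ b = -(t * (α.num * β.den + β.num * α.den)) ∧
      c = t * (α.num * β.num) := by
  have hq : (α.den : ℤ) ≠ 0 := by exact_mod_cast α.den_ne_zero
  have hs : (β.den : ℤ) ≠ 0 := by exact_mod_cast β.den_ne_zero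
  have cα : IsCoprime (α.den : ℤ) α.num := by
    rw [Int.isCoprime_iff_gcd_eq_one, Int.gcd_comm]; exact α.reduced
  have cβ : IsCoprime (β.den : ℤ) β.num := by
    rw [Int.isCoprime_iff_gcd_eq_one, Int.gcd_comm]; exact β.reduced
  have eα : α * α.den = α.num := Rat.mul_den_eq_num α
  have eβ : β * β.den = β.num := Rat.mul_den_eq_num β
  have hQ1 : (a : ℚ) * (α.num * β.den + β.num * α.den) = -b * (α.den * β.den) := by
    rw [← eα, ← eβ]; linear_combination (α.den * β.den : ℚ) * h1
  have hQ2 : (a : ℚ) * (α.num * β.num) = c * (α.den * β.den) := by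
    rw [← eα, ← eβ]; linear_combination (α.den * β.den : ℚ) * h2
  have hQ3 : (a : ℚ) * α.num ^ 2 + b * α.num * α.den + c * α.den ^ 2 = 0 := by
    rw [← eα]; linear_combination (α * α.den ^ 2 : ℚ) * h1 - (α.den ^ 2 : ℚ) * h2 
  have hZ1 : a * (α.num * β.den + β.num * α.den) = -b * (α.den * β.den) := by exact_mod_cast hQ1
  have hZ2 : a * (α.num * β.num) = c * (α.den * β.den) := by exact_mod_cast hQ2
  have hZ3 : a * α.num ^ 2 + b * α.num * α.den + c * α.den ^ 2 = 0 := by exact_mod_cast hQ3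
  generalize (α.den : ℤ) = q at *
  generalize (β.den : ℤ) = s at *
  generalize α.num = p at *
  generalize β.num = r at *
  obtain ⟨a₁, rfl⟩ : q ∣ a :=
    (cα.pow_right (n := 2)).dvd_of_dvd_mul_right ⟨-b * p - c * q, by linear_combination hZ3⟩
  have hZ4 : a₁ * (p * s + r * q) = -b * s :=
    mul_left_cancel₀ hq (by linear_combination hZ1)
  have hZ5 : a₁ * (p * r) = c * s := mul_left_cancel₀ hq (by linear_combination hZ2)
  have d1 : s ∣ a₁ * p := cβ.dvd_of_dvd_mul_right ⟨c, by linear_combination hZ5⟩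
  have d2 : s ∣ a₁ * q :=
    cβ.dvd_of_dvd_mul_right ⟨-b - a₁ * p, by linear_combination hZ4⟩
  obtain ⟨t, rfl⟩ : s ∣ a₁ := by
    obtain ⟨x, y, hxy⟩ := cα
    have : a₁ = x * (a₁ * q) + y * (a₁ * p) := by linear_combination -a₁ * hxy
    rw [this]
    exact dvd_add (d2.mul_left _) (d1.mul_left _)
  refine ⟨t, ?_, by ring, mul_left_cancel₀ hs (by linear_combination hZ4),
    mul_left_cancel₀ hs (by linear_combination -hZ5)⟩
  rintro rfl
  simp at ha

/-- Triples `(a, b, c)` for which `a X² + b X + c` has two rational roots that are, up to sign,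
nonzero powers of the same positive rational number different from `1`. -/
def RatFamily (a b c : ℤ) : Prop :=
  ∃ (t : ℤ) (α β γ : ℚ) (m n : ℤ), t ≠ 0 ∧ 0 < γ ∧ γ ≠ 1 ∧ m ≠ 0 ∧ n ≠ 0 ∧
    |α| = γ ^ m ∧ |β| = γ ^ n ∧ a = t * (α.den * β.den) ∧
    b = -(t * (α.num * β.den + β.num * α.den)) ∧ c = t * (α.num * β.num)

lemma quad_eval_one {a b c : ℤ} {α β : ℂ} (h1 : a * (α + β) = -b) (h2 : a * (α * β) = c)
    (hα : α = 1) : a + b + c = 0 := by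
  subst hα
  have : (a + b + c : ℂ) = 0 := by linear_combination h1 - h2
  exact_mod_cast this

lemma quad_eval_neg_one {a b c : ℤ} {α β : ℂ} (h1 : a * (α + β) = -b) (h2 : a * (α * β) = c)
    (hα : α = -1) : a - b + c = 0 := by
  subst hα
  have : (a - b + c : ℂ) = 0 := by linear_combination -h1 - h2
  exact_mod_cast this

lemma ratFamily_of_rat_roots {a b c : ℤ} {α β : ℚ} (ha : a ≠ 0) (hα : α ≠ 0) (hβ : β ≠ 0)
    (h1 : a * (α + β) = -b) (h2 : a * (α * β) = c) {k l : ℤ} (hkl : k ≠ 0 ∨ l ≠ 0)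
    (h : α ^ k * β ^ l = 1) : a + b + c = 0 ∨ a - b + c = 0 ∨ RatFamily a b c := by
  have h1' : (a : ℂ) * ((α : ℂ) + (β : ℂ)) = -b := by exact_mod_cast h1
  have h2' : (a : ℂ) * ((α : ℂ) * (β : ℂ)) = c := by exact_mod_cast h2
  have h1'' : (a : ℂ) * ((β : ℂ) + (α : ℂ)) = -b := by rw [add_comm, h1']
  have h2'' : (a : ℂ) * ((β : ℂ) * (α : ℂ)) = c := by rw [mul_comm (β : ℂ), h2']
  by_cases a1 : α = 1
  · exact Or.inl (quad_eval_one h1' h2' (by exact_mod_cast a1))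
  by_cases a2 : α = -1
  · exact Or.inr (Or.inl (quad_eval_neg_one h1' h2' (by exact_mod_cast a2)))
  by_cases b1 : β = 1
  · exact Or.inl (quad_eval_one h1'' h2'' (by exact_mod_cast b1))
  by_cases b2 : β = -1
  · exact Or.inr (Or.inl (quad_eval_neg_one h1'' h2'' (by exact_mod_cast b2)))
  have hk : k ≠ 0 := by
    rintro rfl
    have hl : l ≠ 0 := by simpa using hkl
    rcases rat_eq_one_or_neg_one_of_zpow hl (by simpa using h) with h | h <;> contradiction
  have hl : l ≠ 0 := by
    rintro rfl
    rcases rat_eq_one_or_neg_one_of_zpow hk (by simpa using h) with h | h <;> contradiction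
  obtain ⟨γ, m, n, hγ, hm, hn, e1, e2⟩ := exists_rat_base hα hβ hk hl h
  obtain ⟨t, ht, f1, f2, f3⟩ := exists_rat_factorization ha h1 h2
  refine Or.inr (Or.inr ⟨t, α, β, γ, m, n, ht, hγ, ?_, hm, hn, e1, e2, f1, f2, f3⟩)
  rintro rfl
  rw [one_zpow] at e1
  rcases eq_or_eq_neg_of_abs_eq e1 with h | h <;> contradiction

lemma classification {a b c : ℤ} (ha : a ≠ 0) (hc : c ≠ 0) (h : MulDep (nzRoots (quad a b c))) :
    (c = a ∨ c = -a ∨ b = 0 ∨ a + b + c = 0 ∨ a - b + c = 0) ∨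
      (∃ j : ℕ, 1 ≤ j ∧ j ≤ 4 ∧ b ^ 2 = j * (a * c)) ∨ RatFamily a b c := by
  obtain ⟨α, β, h1, h2, hα, hβ, hS⟩ := nzRoots_quad_eq (b := b) ha hc
  have haC : (a : ℂ) ≠ 0 := Int.cast_ne_zero.2 ha
  have haQ : (a : ℚ) ≠ 0 := Int.cast_ne_zero.2 ha
  rw [hS] at h
  by_cases hab : α = β
  · right; left
    refine ⟨4, by norm_num, le_rfl, ?_⟩
    subst hab
    have : (b : ℂ) ^ 2 = 4 * (a * c) := by
      rw [← h2]; linear_combination (b - a * (α + α)) * h1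
    exact_mod_cast this
  obtain ⟨e, he, hprod⟩ := h
  rw [Finset.prod_pair hab] at hprod
  have hkl : e α ≠ 0 ∨ e β ≠ 0 := by simpa using he
  generalize e α = k at *
  generalize e β = l at *
  have hs : α + β = ((-b / a : ℚ) : ℂ) := by
    push_cast; rw [eq_div_iff haC, mul_comm]; exact h1
  have hp : α * β = ((c / a : ℚ) : ℂ) := by
    push_cast; rw [eq_div_iff haC, mul_comm]; exact h2
  by_cases hkl' : k = l
  · left
    subst hkl'
    have hk : k ≠ 0 := by simpa using hkl
    rw [← mul_zpow, hp] at hprod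
    rcases rat_eq_one_or_neg_one_of_zpow (x := c / a) hk (by exact_mod_cast hprod) with h | h
    · rw [div_eq_iff haQ, one_mul] at h
      exact Or.inl (by exact_mod_cast h)
    · rw [div_eq_iff haQ, neg_one_mul] at h
      exact Or.inr (Or.inl (by exact_mod_cast h))
  by_cases hirr : ∀ q : ℚ, α ≠ q
  · obtain ⟨n, hn, ρ, hρ⟩ : ∃ n : ℕ, n ≠ 0 ∧ ∃ ρ : ℚ, α ^ n = ρ := by
      have key : α ^ (k - l) = (((c / a : ℚ) ^ (-l) : ℚ) : ℂ) := by
        rw [Rat.cast_zpow, ← hp, zpow_neg, mul_zpow, zpow_sub₀ hα]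
        have : α ^ l ≠ 0 := zpow_ne_zero _ hα
        have : β ^ l ≠ 0 := zpow_ne_zero _ hβ
        field_simp
        exact hprod
      refine ⟨(k - l).natAbs, by omega, ?_⟩
      rcases Int.natAbs_eq (k - l) with h | h
      · exact ⟨_, by rw [← zpow_natCast, ← h, key]⟩
      · refine ⟨((c / a : ℚ) ^ (-l))⁻¹, ?_⟩
        rw [h, zpow_neg, zpow_natCast] at key
        rw [Rat.cast_inv, ← key, inv_inv]
    have hpow := pow_eq_pow_of_rat_pow hs hp hirr hρ
    have hζ : (α / β) ^ n = 1 := by rw [div_pow, hpow, div_self (pow_ne_zero _ hβ)]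
    have hq : α / β + (α / β)⁻¹ = ((b ^ 2 / (a * c) - 2 : ℚ) : ℂ) := by
      push_cast
      have e1 : (b : ℂ) ^ 2 = (a * (α + β)) ^ 2 := by rw [h1]; ring
      rw [e1, ← h2]
      field_simp
      ring
    obtain ⟨j, hj, hj2⟩ := exists_int_of_add_inv_eq_rat hn hζ hq
    have hb : b ^ 2 = (j + 2) * (a * c) := by
      have : (b : ℚ) ^ 2 = (j + 2) * (a * c) := by rw [← hj]; field_simp; ring
      exact_mod_cast this
    rw [abs_le] at hj2
    by_cases hj0 : j = -2
    · left; right; right; left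
      subst hj0
      simpa using hb
    · right; left
      refine ⟨(j + 2).toNat, by omega, by omega, ?_⟩
      rw [hb, Int.toNat_of_nonneg (by omega)]
  · push Not at hirr
    obtain ⟨p, rfl⟩ := hirr
    obtain ⟨r, rfl⟩ : ∃ r : ℚ, β = r :=
      ⟨-b / a - p, by rw [Rat.cast_sub, ← hs]; ring⟩
    rcases ratFamily_of_rat_roots (α := p) (β := r) ha (by exact_mod_cast hα)
      (by exact_mod_cast hβ) (by exact_mod_cast h1) (by exact_mod_cast h2) hkl
      (by exact_mod_cast hprod) with h | h | h
    · simp [h]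
    · simp [h]
    · exact Or.inr (Or.inr h)

lemma classification_of_const_eq_zero {a b : ℤ} (ha : a ≠ 0)
    (h : MulDep (nzRoots (quad a b 0))) : a + b = 0 ∨ a - b = 0 := by
  have haC : (a : ℂ) ≠ 0 := Int.cast_ne_zero.2 ha
  have haQ : (a : ℚ) ≠ 0 := Int.cast_ne_zero.2 ha
  obtain ⟨e, ⟨z, hz, hez⟩, hprod⟩ := h
  have hval : ∀ w ∈ nzRoots (quad a b 0), w = ((-b / a : ℚ) : ℂ) := by
    intro w hw
    obtain ⟨hw1, hw0⟩ := (mem_nzRoots_quad ha w).1 hw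
    have : w * (w * a + b) = 0 := by linear_combination hw1
    push_cast
    rw [eq_div_iff haC]
    linear_combination (mul_eq_zero.1 this).resolve_left hw0
  have hS : nzRoots (quad a b 0) = {z} := by
    ext w
    rw [Finset.mem_singleton]
    constructor
    · intro hw; rw [hval w hw, hval z hz]
    · rintro rfl; exact hz
  rw [hS, Finset.prod_singleton, hval z hz] at hprod
  rw [hval z hz] at hez
  rcases rat_eq_one_or_neg_one_of_zpow (x := -b / a) hez (by exact_mod_cast hprod) with h | h
  · rw [div_eq_iff haQ] at h
    left
    have : (a + b : ℚ) = 0 := by linear_combination -h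
    exact_mod_cast this
  · rw [div_eq_iff haQ] at h
    right
    have : (a - b : ℚ) = 0 := by linear_combination h
    exact_mod_cast this

/-- Coefficient triples bounded by `N` in absolute value. -/
noncomputable def coeffBox (N : ℕ) : Finset (ℤ × ℤ × ℤ) :=
  Finset.Icc (-N : ℤ) N ×ˢ Finset.Icc (-N : ℤ) N ×ˢ Finset.Icc (-N : ℤ) N

lemma mem_coeffBox {N : ℕ} {a b c : ℤ} :
    (a, b, c) ∈ coeffBox N ↔ |a| ≤ N ∧ |b| ≤ N ∧ |c| ≤ N := by
  simp [coeffBox, abs_le]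

lemma coeff_quad (a b c : ℤ) (i : ℕ) : (quad a b c).coeff i =
    if i = 2 then a else if i = 1 then b else if i = 0 then c else 0 := by
  simp only [quad, coeff_add, coeff_C_mul, coeff_X_pow, coeff_X, coeff_C]
  rcases i with _ | _ | _ | i <;> simp

lemma quad_injective : Function.Injective fun v : ℤ × ℤ × ℤ => quad v.1 v.2.1 v.2.2 := by
  rintro ⟨a, b, c⟩ ⟨a', b', c'⟩ h
  have h0 := congrArg (fun f => coeff f 0) h
  have h1 := congrArg (fun f => coeff f 1) h
  have h2 := congrArg (fun f => coeff f 2) h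
  simp [coeff_quad] at h0 h1 h2
  simp [h0, h1, h2]

lemma heightLe_quad_iff {a b c H : ℤ} (hH : 0 ≤ H) :
    HeightLe (quad a b c) H ↔ |a| ≤ H ∧ |b| ≤ H ∧ |c| ≤ H := by
  constructor
  · intro h
    have h0 := h 0
    have h1 := h 1
    have h2 := h 2
    simp [coeff_quad] at h0 h1 h2
    exact ⟨h2, h1, h0⟩
  · rintro ⟨ha, hb, hc⟩ i
    rcases i with _ | _ | _ | i <;> simp [coeff_quad, *]

open Classical in
lemma ncard_MstarSet_two (N : ℕ) :
    (MstarSet 2 N).ncard =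
      ((coeffBox N).filter fun v => v.1 ≠ 0 ∧ MulDep (nzRoots (quad v.1 v.2.1 v.2.2))).card := by
  rw [← Set.ncard_coe_finset, ← Set.ncard_image_of_injective _ quad_injective]
  congr 1
  ext f
  simp only [Set.mem_image, Finset.mem_coe, Finset.mem_filter, Prod.exists, mem_coeffBox]
  constructor
  · rintro ⟨hd, hh, -, hm⟩
    have hf : f = quad (f.coeff 2) (f.coeff 1) (f.coeff 0) :=
      eq_quadratic_of_degree_le_two (natDegree_le_iff_degree_le.1 hd.le)
    have ha : f.coeff 2 ≠ 0 := by
      have : f ≠ 0 := by rintro rfl; simp at hd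
      rw [← hd]; exact leadingCoeff_ne_zero.2 this
    exact ⟨_, _, _, ⟨⟨hh 2, hh 1, hh 0⟩, ha, by rwa [← hf]⟩, hf.symm⟩
  · rintro ⟨a, b, c, ⟨hbox, ha, hm⟩, rfl⟩
    have hd : (quad a b c).natDegree = 2 := natDegree_quadratic ha
    exact ⟨hd, (heightLe_quad_iff (by positivity)).2 hbox, hd.ge, hm⟩

lemma sum_Icc_inv_le (K : ℕ) : ∑ s ∈ Finset.Icc 1 K, ((s : ℝ))⁻¹ ≤ 1 + Real.log K := by
  have := harmonic_le_one_add_log K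
  rw [harmonic_eq_sum_Icc] at this
  push_cast at this
  exact this

lemma exists_common_squarefree_part {A B C : ℕ} (hA : A ≠ 0) (h : B ^ 2 = A * C) :
    ∃ s x y : ℕ, A = s * x ^ 2 ∧ C = s * y ^ 2 := by
  obtain ⟨s, x, hsx, hs⟩ := Nat.sq_mul_squarefree A
  have hx : x ≠ 0 := by rintro rfl; simp at hsx; omega
  obtain ⟨z, rfl⟩ : x ∣ B := by
    rw [← Nat.pow_dvd_pow_iff two_ne_zero, h, ← hsx]
    exact ⟨s * C, by ring⟩
  have hz : z ^ 2 = s * C :=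
    Nat.eq_of_mul_eq_mul_left (by positivity : 0 < x ^ 2) (by rw [← mul_assoc, hsx, ← h]; ring)
  obtain ⟨w, rfl⟩ : s ∣ z := (hs.dvd_pow_iff_dvd two_ne_zero).1 ⟨C, hz⟩
  refine ⟨s, x, w, by rw [← hsx]; ring, ?_⟩
  have hs0 : s ≠ 0 := hs.ne_zero
  exact Nat.eq_of_mul_eq_mul_left (Nat.pos_of_ne_zero hs0) (by rw [← hz]; ring)

/-- The two signs. -/
def signs : Finset ℤ := {1, -1}

lemma card_signs : signs.card = 2 := rfl

lemma exists_sign_mul (a : ℤ) : ∃ e ∈ signs, a = e * (a.natAbs : ℤ) := by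
  rcases Int.natAbs_eq a with h | h
  · exact ⟨1, by simp [signs], by rw [one_mul]; exact h⟩
  · exact ⟨-1, by simp [signs], by rw [neg_one_mul]; exact h⟩

lemma le_sqrt_div {s x K : ℕ} (hs : 0 < s) (h : s * x ^ 2 ≤ K) : x ≤ Nat.sqrt (K / s) := by
  rw [Nat.le_sqrt, Nat.le_div_iff_mul_le hs]
  calc x * x * s = s * x ^ 2 := by ring
    _ ≤ K := h

open Classical in
lemma card_square_family_le (N : ℕ) :
    (((coeffBox N).filter fun v : ℤ × ℤ × ℤ => v.1 ≠ 0 ∧ v.2.2 ≠ 0 ∧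
      ∃ j : ℕ, 1 ≤ j ∧ j ≤ 4 ∧ v.2.1 ^ 2 = (j : ℤ) * (v.1 * v.2.2)).card : ℝ) ≤
      128 * N * (1 + Real.log (4 * N)) := by
  set S := (coeffBox N).filter fun v : ℤ × ℤ × ℤ => v.1 ≠ 0 ∧ v.2.2 ≠ 0 ∧
      ∃ j : ℕ, 1 ≤ j ∧ j ≤ 4 ∧ v.2.1 ^ 2 = (j : ℤ) * (v.1 * v.2.2) with hS
  let X : ℕ → Finset (ℕ × ℤ × ℤ × ℤ × ℕ × ℕ) := fun s =>
    Finset.Icc 1 4 ×ˢ signs ×ˢ signs ×ˢ signs ×ˢ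
      Finset.Icc 1 (Nat.sqrt (4 * N / s)) ×ˢ Finset.Icc 1 (Nat.sqrt (4 * N / s))
  let g : ℕ → ℕ × ℤ × ℤ × ℤ × ℕ × ℕ → ℤ × ℤ × ℤ := fun s u =>
    (u.2.1 * ((s * u.2.2.2.2.1 ^ 2 / u.1 : ℕ) : ℤ),
      u.2.2.1 * ((s * u.2.2.2.2.1 * u.2.2.2.2.2 : ℕ) : ℤ),
      u.2.2.2.1 * ((s * u.2.2.2.2.2 ^ 2 : ℕ) : ℤ))
  have hsub : S ⊆ (Finset.Icc 1 (4 * N)).biUnion fun s => (X s).image (g s) := by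
    rintro ⟨a, b, c⟩ hv
    rw [hS, Finset.mem_filter, mem_coeffBox] at hv
    obtain ⟨⟨hba, -, hbc⟩, ha, hc, j, hj1, hj4, hj⟩ := hv
    dsimp only at ha hc hj
    have hn : b.natAbs ^ 2 = (j * a.natAbs) * c.natAbs := by
      have := congrArg Int.natAbs hj
      rw [Int.natAbs_pow, Int.natAbs_mul, Int.natAbs_mul, Int.natAbs_natCast] at this
      rw [this]; ring
    have ha' : a.natAbs ≠ 0 := Int.natAbs_ne_zero.2 ha
    have hc' : c.natAbs ≠ 0 := Int.natAbs_ne_zero.2 hc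
    have hba' : a.natAbs ≤ N := by rw [Int.abs_eq_natAbs] at hba; omega
    have hbc' : c.natAbs ≤ N := by rw [Int.abs_eq_natAbs] at hbc; omega
    have hja : j * a.natAbs ≠ 0 := mul_ne_zero (by omega) ha'
    obtain ⟨s, x, y, e1, e2⟩ := exists_common_squarefree_part hja hn
    have hs : s ≠ 0 := by rintro rfl; simp at e2; omega
    have hx : x ≠ 0 := by rintro rfl; simp at e1; omega
    have hy : y ≠ 0 := by rintro rfl; simp at e2; omega
    have hjN : j * a.natAbs ≤ 4 * N := Nat.mul_le_mul hj4 hba'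
    have hb : b.natAbs = s * x * y := by
      rw [e1, e2] at hn
      exact Nat.pow_left_injective two_ne_zero (by dsimp only; rw [hn]; ring)
    obtain ⟨ε₁, h₁, f1⟩ := exists_sign_mul a
    obtain ⟨ε₂, h₂, f2⟩ := exists_sign_mul b
    obtain ⟨ε₃, h₃, f3⟩ := exists_sign_mul c
    rw [Finset.mem_biUnion]
    refine ⟨s, ?_, Finset.mem_image.2 ⟨(j, ε₁, ε₂, ε₃, x, y), ?_, ?_⟩⟩
    · rw [Finset.mem_Icc]
      refine ⟨by omega, ?_⟩
      calc s ≤ s * y ^ 2 := Nat.le_mul_of_pos_right _ (by positivity)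
        _ ≤ 4 * N := by omega
    · simp only [X, Finset.mem_product, Finset.mem_Icc]
      exact ⟨⟨hj1, hj4⟩, h₁, h₂, h₃,
        ⟨by omega, le_sqrt_div (by omega) (by omega)⟩,
        ⟨by omega, le_sqrt_div (by omega) (by omega)⟩⟩
    · simp only [g, Prod.mk.injEq]
      refine ⟨?_, ?_, ?_⟩
      · rw [← e1, Nat.mul_div_cancel_left _ (by omega)]; exact f1.symm
      · rw [← hb]; exact f2.symm
      · rw [← e2]; exact f3.symm
  have hX : ∀ s, (((X s).image (g s)).card : ℝ) ≤ 128 * N * (s : ℝ)⁻¹ := by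
    intro s
    have h1 : ((X s).image (g s)).card ≤ 32 * (4 * N / s) := by
      refine Finset.card_image_le.trans ?_
      simp only [X, Finset.card_product, card_signs, Nat.card_Icc, Nat.add_sub_cancel]
      have := Nat.sqrt_le (4 * N / s)
      linarith
    calc (((X s).image (g s)).card : ℝ) ≤ ((32 * (4 * N / s) : ℕ) : ℝ) := by exact_mod_cast h1
      _ = 32 * ((4 * N / s : ℕ) : ℝ) := by push_cast; ring
      _ ≤ 32 * (((4 * N : ℕ) : ℝ) / s) := by gcongr; exact Nat.cast_div_le
      _ = 128 * N * (s : ℝ)⁻¹ := by push_cast; ring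
  calc (S.card : ℝ) ≤ (∑ s ∈ Finset.Icc 1 (4 * N), ((X s).image (g s)).card : ℕ) := by
        exact_mod_cast (Finset.card_le_card hsub).trans Finset.card_biUnion_le
    _ = ∑ s ∈ Finset.Icc 1 (4 * N), (((X s).image (g s)).card : ℝ) := by push_cast; rfl
    _ ≤ ∑ s ∈ Finset.Icc 1 (4 * N), 128 * N * (s : ℝ)⁻¹ := Finset.sum_le_sum fun s _ => hX s
    _ = 128 * N * ∑ s ∈ Finset.Icc 1 (4 * N), (s : ℝ)⁻¹ := by rw [Finset.mul_sum]
    _ ≤ 128 * N * (1 + Real.log (4 * N)) := by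
        gcongr
        exact_mod_cast sum_Icc_inv_le (4 * N)

lemma abs_mul_max_mul_max_le {t p q r s N : ℤ} (h1 : |t * (q * s)| ≤ N)
    (h2 : |t * (p * s + r * q)| ≤ N) (h3 : |t * (p * r)| ≤ N) :
    |t| * (max |p| |q| * max |r| |s|) ≤ 2 * N := by
  have hN : 0 ≤ N := (abs_nonneg _).trans h1
  have key : ∀ x y : ℤ, |x + y| ≤ N → |x| * |y| ≤ N ^ 2 → |x| ≤ 2 * N := by
    intro x y hxy hp
    by_contra! h
    have h4 : |x| - |y| ≤ |x + y| := by simpa using abs_sub_abs_le_abs_sub x (-y)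
    nlinarith [abs_nonneg y]
  have hprod : |t * (p * s)| * |t * (r * q)| ≤ N ^ 2 := by
    rw [← abs_mul, show t * (p * s) * (t * (r * q)) = t * (q * s) * (t * (p * r)) by ring, abs_mul,
      sq]
    exact mul_le_mul h1 h3 (abs_nonneg _) hN
  have h4 := key (t * (p * s)) (t * (r * q)) (by rwa [← mul_add]) hprod
  have h5 := key (t * (r * q)) (t * (p * s)) (by rwa [← mul_add, add_comm]) (by rwa [mul_comm])
  rw [abs_mul, abs_mul] at h1 h3 h4 h5
  rcases max_choice |p| |q| with e | e <;> rcases max_choice |r| |s| with e' | e' <;>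
    rw [e, e'] <;> linarith

lemma natAbs_num_pow_le {α γ : ℚ} {m : ℤ} (hγ : 0 < γ) (h : |α| = γ ^ m) :
    γ.num.natAbs ^ m.natAbs ≤ max α.num.natAbs α.den := by
  have hn : |α|.num.natAbs = α.num.natAbs := by
    rcases abs_choice α with h | h <;> simp [h]
  have hd : |α|.den = α.den := by
    rcases abs_choice α with h | h <;> simp [h]
  rw [← hn, ← hd, h]
  rcases Int.natAbs_eq m with e | e
  · apply le_max_of_le_left
    conv_rhs => rw [e]
    rw [zpow_natCast, Rat.num_pow, Int.natAbs_pow]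
  · apply le_max_of_le_right
    conv_rhs => rw [e]
    rw [zpow_neg, zpow_natCast, Rat.den_inv_of_ne_zero (by positivity), Rat.num_pow,
      Int.natAbs_pow]

lemma ratFamily_exists_base_gt_one {a b c : ℤ} (h : RatFamily a b c) :
    ∃ (t : ℤ) (α β γ : ℚ) (m n : ℤ), t ≠ 0 ∧ 1 < γ ∧ m ≠ 0 ∧ n ≠ 0 ∧
    |α| = γ ^ m ∧ |β| = γ ^ n ∧ a = t * (α.den * β.den) ∧
    b = -(t * (α.num * β.den + β.num * α.den)) ∧ c = t * (α.num * β.num) := by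
  obtain ⟨t, α, β, γ, m, n, ht, hγ, hγ1, hm, hn, e1, e2, f⟩ := h
  rcases lt_or_gt_of_ne hγ1 with h | h
  · exact ⟨t, α, β, γ⁻¹, -m, -n, ht, (one_lt_inv₀ hγ).2 h, neg_ne_zero.2 hm, neg_ne_zero.2 hn,
      by rw [inv_zpow', neg_neg, e1], by rw [inv_zpow', neg_neg, e2], f⟩
  · exact ⟨t, α, β, γ, m, n, ht, h, hm, hn, e1, e2, f⟩

lemma sum_half_pow_le (K : ℕ) : ∑ m ∈ Finset.Icc 1 K, ((2 : ℝ) ^ m)⁻¹ ≤ 1 := by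
  have : ∑ m ∈ Finset.Icc 1 K, ((2 : ℝ) ^ m)⁻¹ = 1 - (2 ^ K)⁻¹ := by
    induction K with
    | zero => simp
    | succ K ih => rw [Finset.sum_Icc_succ_top (by omega), ih, pow_succ]; field_simp; ring
  rw [this]
  have : (0 : ℝ) ≤ (2 ^ K)⁻¹ := by positivity
  linarith

lemma exists_sign_mul_zpow {α γ : ℚ} {m : ℤ} (h : |α| = γ ^ m) :
    ∃ e ∈ signs, ∃ e' ∈ signs, α = (e : ℚ) * γ ^ (e' * (m.natAbs : ℤ)) := by
  obtain ⟨e', he', hm⟩ := exists_sign_mul m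
  rw [hm] at h
  rcases abs_choice α with h' | h'
  · exact ⟨1, by simp [signs], e', he', by rw [← h', h]; simp⟩
  · refine ⟨-1, by simp [signs], e', he', ?_⟩
    rw [h'] at h
    rw [← h]; simp

open Classical in
lemma card_ratFamily_le (N : ℕ) :
    (((coeffBox N).filter fun v : ℤ × ℤ × ℤ => RatFamily v.1 v.2.1 v.2.2).card : ℝ) ≤
      256 * N * (1 + Real.log (2 * N)) := by
  set S := (coeffBox N).filter fun v : ℤ × ℤ × ℤ => RatFamily v.1 v.2.1 v.2.2 with hS
  let τ : ℕ → ℕ → ℕ → ℕ := fun h m n => 2 * N / h ^ (m + n)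
  let X : ℕ → ℕ → ℕ → Finset (ℕ × ℤ × ℤ × ℤ × ℤ × ℤ × ℕ) := fun h m n =>
    Finset.Icc 1 h ×ˢ signs ×ˢ signs ×ˢ signs ×ˢ signs ×ˢ signs ×ˢ Finset.Icc 1 (τ h m n)
  let F : ℤ → ℚ → ℚ → ℤ × ℤ × ℤ := fun t α β =>
    (t * (α.den * β.den), -(t * (α.num * β.den + β.num * α.den)), t * (α.num * β.num))
  let g : ℕ → ℕ → ℕ → ℕ × ℤ × ℤ × ℤ × ℤ × ℤ × ℕ → ℤ × ℤ × ℤ := fun h m n u =>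
    F (u.2.2.2.2.2.1 * u.2.2.2.2.2.2)
      ((u.2.1 : ℚ) * ((h : ℚ) / u.1) ^ (u.2.2.1 * (m : ℤ)))
      ((u.2.2.2.1 : ℚ) * ((h : ℚ) / u.1) ^ (u.2.2.2.2.1 * (n : ℤ)))
  let I := Finset.Icc 1 (2 * N)
  let I₂ := Finset.Icc 2 (2 * N)
  have hsub : S ⊆ I₂.biUnion fun h => I.biUnion fun m => I.biUnion fun n =>
      (X h m n).image (g h m n) := by
    rintro ⟨a, b, c⟩ hv
    rw [hS, Finset.mem_filter, mem_coeffBox] at hv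
    obtain ⟨⟨hba, hbb, hbc⟩, hR⟩ := hv
    obtain ⟨t, α, β, γ, m, n, ht, hγ, hm, hn, e1, e2, rfl, rfl, rfl⟩ :=
      ratFamily_exists_base_gt_one hR
    rw [abs_neg] at hbb
    have hγ0 : 0 < γ := zero_lt_one.trans hγ
    have hbound := abs_mul_max_mul_max_le hba hbb hbc
    have b1 := natAbs_num_pow_le hγ0 e1
    have b2 := natAbs_num_pow_le hγ0 e2
    have hnum : 0 < γ.num := Rat.num_pos.2 hγ0
    have hlt : (γ.den : ℤ) < γ.num := by
      have h1 : (γ.den : ℚ) < γ.num := by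
        rw [← Rat.mul_den_eq_num γ]
        have : (0 : ℚ) < γ.den := by exact_mod_cast γ.den_pos
        nlinarith
      exact_mod_cast h1
    have hden := γ.den_pos
    have hγe : γ = (γ.num.natAbs : ℚ) / (γ.den : ℚ) := by
      have : ((γ.num.natAbs : ℕ) : ℚ) = γ.num := by
        rw [← Int.cast_natCast, Int.natAbs_of_nonneg hnum.le]
      rw [this, Rat.num_div_den]
    obtain ⟨h, hh⟩ : ∃ h, h = γ.num.natAbs := ⟨_, rfl⟩
    rw [← hh] at b1 b2 hγe
    have hh2 : 2 ≤ h := by omega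
    have hbN : t.natAbs * h ^ (m.natAbs + n.natAbs) ≤ 2 * N := by
      have h1 : t.natAbs * (max α.num.natAbs α.den * max β.num.natAbs β.den) ≤ 2 * N := by
        zify
        simpa using hbound
      rw [pow_add]
      exact (Nat.mul_le_mul_left _ (Nat.mul_le_mul b1 b2)).trans h1
    have ht1 : 1 ≤ t.natAbs := by omega
    have hm1 : 1 ≤ m.natAbs := by omega
    have hn1 : 1 ≤ n.natAbs := by omega
    have hpow : h ^ (m.natAbs + n.natAbs) ≤ 2 * N := (Nat.le_mul_of_pos_left _ ht1).trans hbN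
    have hpos : 0 < h ^ (m.natAbs + n.natAbs) := by positivity
    have hself : m.natAbs + n.natAbs ≤ 2 * N := (Nat.lt_pow_self hh2).le.trans hpow
    have hhN : h ≤ 2 * N := (Nat.le_self_pow (by omega) h).trans hpow
    obtain ⟨ε₁, h₁, ε₂, h₂, f1⟩ := exists_sign_mul_zpow e1
    obtain ⟨ε₃, h₃, ε₄, h₄, f2⟩ := exists_sign_mul_zpow e2
    obtain ⟨ε₅, h₅, f3⟩ := exists_sign_mul t
    simp only [Finset.mem_biUnion, Finset.mem_image]
    refine ⟨h, Finset.mem_Icc.2 ⟨hh2, hhN⟩, m.natAbs, Finset.mem_Icc.2 ⟨hm1, by omega⟩,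
      n.natAbs, Finset.mem_Icc.2 ⟨hn1, by omega⟩, (γ.den, ε₁, ε₂, ε₃, ε₄, ε₅, t.natAbs), ?_, ?_⟩
    · simp only [X, Finset.mem_product, Finset.mem_Icc]
      exact ⟨⟨hden, by omega⟩, h₁, h₂, h₃, h₄, h₅, ht1, (Nat.le_div_iff_mul_le hpos).2 hbN⟩
    · simp only [g]
      rw [← hγe, ← f1, ← f2, ← f3]
  have hX : ∀ h ∈ I₂, ∀ m ∈ I, ∀ n ∈ I, (((X h m n).image (g h m n)).card : ℝ) ≤
      256 * N * ((h : ℝ)⁻¹ * (((2 : ℝ) ^ m)⁻¹ * ((2 : ℝ) ^ n)⁻¹)) := by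
    intro h hh m hm n hn
    have hh2 : 2 ≤ h := (Finset.mem_Icc.1 hh).1
    have hm1 : 1 ≤ m := (Finset.mem_Icc.1 hm).1
    have hn1 : 1 ≤ n := (Finset.mem_Icc.1 hn).1
    have h1 : ((X h m n).image (g h m n)).card ≤ 32 * h * τ h m n := by
      refine Finset.card_image_le.trans (le_of_eq ?_)
      simp only [X, Finset.card_product, card_signs, Nat.card_Icc, Nat.add_sub_cancel]
      ring
    have hhR : (2 : ℝ) ≤ h := by exact_mod_cast hh2
    obtain ⟨k, hk⟩ : ∃ k, m + n = k + 2 := ⟨m + n - 2, by omega⟩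
    calc (((X h m n).image (g h m n)).card : ℝ) ≤ ((32 * h * τ h m n : ℕ) : ℝ) := by
          exact_mod_cast h1
      _ = 32 * h * (τ h m n : ℝ) := by push_cast; ring
      _ ≤ 32 * h * (((2 * N : ℕ) : ℝ) / ((h ^ (m + n) : ℕ) : ℝ)) := by
          gcongr; exact Nat.cast_div_le
      _ = 64 * N * (h : ℝ)⁻¹ * ((h : ℝ) ^ k)⁻¹ := by
          rw [hk]; push_cast; field_simp; ring
      _ ≤ 64 * N * (h : ℝ)⁻¹ * ((2 : ℝ) ^ k)⁻¹ := by gcongr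
      _ = 256 * N * ((h : ℝ)⁻¹ * (((2 : ℝ) ^ m)⁻¹ * ((2 : ℝ) ^ n)⁻¹)) := by
          rw [← mul_inv ((2 : ℝ) ^ m), ← pow_add, hk, pow_add, mul_inv]; ring
  have hsum : (S.card : ℝ) ≤ ∑ h ∈ I₂, ∑ m ∈ I, ∑ n ∈ I,
      (((X h m n).image (g h m n)).card : ℝ) := by
    have : S.card ≤ ∑ h ∈ I₂, ∑ m ∈ I, ∑ n ∈ I, ((X h m n).image (g h m n)).card :=
      (Finset.card_le_card hsub).trans <| Finset.card_biUnion_le.trans <|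
        Finset.sum_le_sum fun h _ => Finset.card_biUnion_le.trans <|
          Finset.sum_le_sum fun m _ => Finset.card_biUnion_le
    exact_mod_cast this
  have hhalf : ∑ m ∈ I, ((2 : ℝ) ^ m)⁻¹ ≤ 1 := sum_half_pow_le (2 * N)
  have hhalf0 : 0 ≤ ∑ m ∈ I, ((2 : ℝ) ^ m)⁻¹ := Finset.sum_nonneg fun _ _ => by positivity
  have hinv : ∑ h ∈ I₂, (h : ℝ)⁻¹ ≤ 1 + Real.log (2 * N) := by
    refine (Finset.sum_le_sum_of_subset_of_nonneg (Finset.Icc_subset_Icc_left (by norm_num))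
      fun _ _ _ => by positivity).trans (?_ : ∑ h ∈ I, (h : ℝ)⁻¹ ≤ _)
    exact_mod_cast sum_Icc_inv_le (2 * N)
  calc (S.card : ℝ) ≤ ∑ h ∈ I₂, ∑ m ∈ I, ∑ n ∈ I,
        256 * N * ((h : ℝ)⁻¹ * (((2 : ℝ) ^ m)⁻¹ * ((2 : ℝ) ^ n)⁻¹)) :=
        hsum.trans <| Finset.sum_le_sum fun h hh => Finset.sum_le_sum fun m hm =>
          Finset.sum_le_sum fun n hn => hX h hh m hm n hn
    _ = 256 * N * ((∑ h ∈ I₂, (h : ℝ)⁻¹) *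
          ((∑ m ∈ I, ((2 : ℝ) ^ m)⁻¹) * ∑ n ∈ I, ((2 : ℝ) ^ n)⁻¹)) := by
        simp only [← Finset.mul_sum, ← Finset.sum_mul]
    _ ≤ 256 * N * ((1 + Real.log (2 * N)) * 1) := by
        gcongr
        · exact (Finset.sum_nonneg fun _ _ => by positivity).trans hinv
        · exact mul_le_one₀ hhalf hhalf0 hhalf
    _ = 256 * N * (1 + Real.log (2 * N)) := by ring

lemma Icc_erase_zero_sum (f : ℤ → ℤ) (N : ℕ) :
    ∑ a ∈ (Finset.Icc (-N : ℤ) N).erase 0, f a =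
      ∑ k ∈ Finset.range N, (f (k + 1) + f (-(k + 1))) := by
  induction N with
  | zero => simp
  | succ N ih =>
    have : (Finset.Icc (-(N + 1 : ℕ) : ℤ) (N + 1 : ℕ)).erase 0 =
        insert ((N : ℤ) + 1) (insert (-((N : ℤ) + 1)) ((Finset.Icc (-N : ℤ) N).erase 0)) := by
      ext x
      simp only [Finset.mem_erase, Finset.mem_Icc, Finset.mem_insert]
      omega
    rw [this, Finset.sum_insert, Finset.sum_insert, ih, Finset.sum_range_succ]
    · ring
    · simp
    · simp; omega

/-- The pairs `(a, c)` in the box with `a ≠ 0` and `|a + c| ≤ N`. -/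
noncomputable def hexagon (N : ℕ) : Finset (Σ _ : ℤ, ℤ) :=
  ((Finset.Icc (-N : ℤ) N).erase 0).sigma fun a =>
    Finset.Icc (max (-N : ℤ) (-N - a)) (min (N : ℤ) (N - a))

lemma card_hexagon (N : ℕ) : ((hexagon N).card : ℤ) = 3 * N ^ 2 + N := by
  rw [hexagon, Finset.card_sigma]
  push_cast
  rw [Icc_erase_zero_sum
    (fun a => ((Finset.Icc (max (-N : ℤ) (-N - a)) (min (N : ℤ) (N - a))).card : ℤ))]
  have h1 : ∀ k ∈ Finset.range N,
      (((Finset.Icc (max (-N : ℤ) (-N - (k + 1))) (min (N : ℤ) (N - (k + 1)))).card : ℤ) +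
      ((Finset.Icc (max (-N : ℤ) (-N - -((k : ℤ) + 1))) (min (N : ℤ) (N - -((k : ℤ) + 1)))).card : ℤ)) =
      4 * N - 2 * k := by
    intro k hk
    rw [Finset.mem_range] at hk
    rw [Int.card_Icc, Int.card_Icc]
    omega
  rw [Finset.sum_congr rfl h1]
  have h2 : ∀ (M : ℤ) (K : ℕ), ∑ k ∈ Finset.range K, (4 * M - 2 * (k : ℤ)) = 4 * M * K - K ^ 2 + K := by
    intro M K
    induction K with
    | zero => simp
    | succ K ih => rw [Finset.sum_range_succ, ih]; push_cast; ring
  rw [h2]; ring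

lemma card_Icc_erase_zero (N : ℕ) : ((Finset.Icc (-N : ℤ) N).erase 0).card = 2 * N := by
  rw [Finset.card_erase_of_mem (by simp), Int.card_Icc]; omega

/-- Triples with constant coefficient `ε` times the leading one. -/
noncomputable def constFamily (ε : ℤ) (N : ℕ) : Finset (ℤ × ℤ × ℤ) :=
  (((Finset.Icc (-N : ℤ) N).erase 0) ×ˢ Finset.Icc (-N : ℤ) N).image
    fun p => (p.1, p.2, ε * p.1)

/-- Triples with vanishing middle coefficient. -/
noncomputable def evenFamily (N : ℕ) : Finset (ℤ × ℤ × ℤ) :=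
  (((Finset.Icc (-N : ℤ) N).erase 0) ×ˢ ((Finset.Icc (-N : ℤ) N).erase 0)).image
    fun p => (p.1, 0, p.2)

/-- Triples with middle coefficient `ε` times the sum of the other two. -/
noncomputable def rootFamily (ε : ℤ) (N : ℕ) : Finset (ℤ × ℤ × ℤ) :=
  (hexagon N).image fun p => (p.1, ε * (p.1 + p.2), p.2)

lemma card_constFamily (ε : ℤ) (N : ℕ) : (constFamily ε N).card = 2 * N * (2 * N + 1) := by
  rw [constFamily, Finset.card_image_of_injective, Finset.card_product, card_Icc_erase_zero,
    Int.card_Icc]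
  · congr 1; omega
  · rintro ⟨a, b⟩ ⟨a', b'⟩ h
    simp at h ⊢; tauto

lemma card_evenFamily (N : ℕ) : (evenFamily N).card = 2 * N * (2 * N) := by
  rw [evenFamily, Finset.card_image_of_injective, Finset.card_product, card_Icc_erase_zero]
  rintro ⟨a, b⟩ ⟨a', b'⟩ h
  simpa using h

lemma card_rootFamily (ε : ℤ) (N : ℕ) : ((rootFamily ε N).card : ℤ) = 3 * N ^ 2 + N := by
  rw [rootFamily, Finset.card_image_of_injective, card_hexagon]
  rintro ⟨a, b⟩ ⟨a', b'⟩ h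
  simp at h ⊢; tauto

lemma mem_constFamily {ε : ℤ} (hε : ε = 1 ∨ ε = -1) {N : ℕ} {a b c : ℤ} :
    (a, b, c) ∈ constFamily ε N ↔ (a, b, c) ∈ coeffBox N ∧ a ≠ 0 ∧ c = ε * a := by
  simp only [constFamily, mem_coeffBox, Finset.mem_image, Finset.mem_product, Finset.mem_erase,
    Finset.mem_Icc, Prod.mk.injEq, Prod.exists, abs_le]
  constructor
  · rintro ⟨x, y, h, rfl, rfl, rfl⟩
    rcases hε with rfl | rfl <;> omega
  · rintro ⟨h, h', rfl⟩
    exact ⟨a, b, by omega, rfl, rfl, rfl⟩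

lemma mem_evenFamily {N : ℕ} {a b c : ℤ} :
    (a, b, c) ∈ evenFamily N ↔ (a, b, c) ∈ coeffBox N ∧ a ≠ 0 ∧ c ≠ 0 ∧ b = 0 := by
  simp only [evenFamily, mem_coeffBox, Finset.mem_image, Finset.mem_product, Finset.mem_erase,
    Finset.mem_Icc, Prod.mk.injEq, Prod.exists, abs_le]
  constructor
  · rintro ⟨x, y, h, rfl, rfl, rfl⟩
    omega
  · rintro ⟨h, h', h'', rfl⟩
    exact ⟨a, c, by omega, rfl, rfl, rfl⟩

lemma mem_rootFamily {ε : ℤ} (hε : ε = 1 ∨ ε = -1) {N : ℕ} {a b c : ℤ} :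
    (a, b, c) ∈ rootFamily ε N ↔ (a, b, c) ∈ coeffBox N ∧ a ≠ 0 ∧ b = ε * (a + c) := by
  simp only [rootFamily, hexagon, mem_coeffBox, Finset.mem_image, Finset.mem_sigma,
    Finset.mem_erase, Finset.mem_Icc, Prod.mk.injEq, Sigma.exists, abs_le]
  constructor
  · rintro ⟨x, y, h, rfl, rfl, rfl⟩
    rcases hε with rfl | rfl <;> omega
  · rintro ⟨h, h', rfl⟩
    refine ⟨a, c, ?_, rfl, rfl, rfl⟩
    rcases hε with rfl | rfl <;> omega

/-- Triples lying in at least two of the principal families all lie here. -/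
noncomputable def overlap (N : ℕ) : Finset (ℤ × ℤ × ℤ) :=
  ((Finset.Icc (-N : ℤ) N).erase 0).biUnion fun a =>
    {(a, 0, a), (a, 0, -a), (a, -2 * a, a), (a, 2 * a, a)}

lemma card_overlap_le (N : ℕ) : (overlap N).card ≤ 8 * N := by
  calc (overlap N).card ≤ ((Finset.Icc (-N : ℤ) N).erase 0).card * 4 :=
        Finset.card_biUnion_le_card_mul _ _ _ fun a _ => Finset.card_le_four
    _ = 8 * N := by rw [card_Icc_erase_zero]; ring

lemma mem_overlap {N : ℕ} {a b c : ℤ} : (a, b, c) ∈ overlap N ↔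
    |a| ≤ N ∧ a ≠ 0 ∧ ((b = 0 ∧ c = a) ∨ (b = 0 ∧ c = -a) ∨ (b = -2 * a ∧ c = a) ∨
      (b = 2 * a ∧ c = a)) := by
  simp only [overlap, Finset.mem_biUnion, Finset.mem_erase, Finset.mem_Icc, Finset.mem_insert,
    Finset.mem_singleton, Prod.mk.injEq, abs_le]
  constructor
  · rintro ⟨x, h, h'⟩
    omega
  · rintro ⟨h, h', h''⟩
    exact ⟨a, by omega, by omega⟩

/-- The triples for which the product or the sum of the two roots is special, or one of the roots
is `1` or `-1`. -/
noncomputable def principal (N : ℕ) : Finset (ℤ × ℤ × ℤ) :=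
  constFamily 1 N ∪ constFamily (-1) N ∪ evenFamily N ∪ rootFamily (-1) N ∪ rootFamily 1 N

lemma mem_principal {N : ℕ} {a b c : ℤ} : (a, b, c) ∈ principal N ↔
    (a, b, c) ∈ coeffBox N ∧ a ≠ 0 ∧
      (c = a ∨ c = -a ∨ (c ≠ 0 ∧ b = 0) ∨ a + b + c = 0 ∨ a - b + c = 0) := by
  simp only [principal, Finset.mem_union, mem_constFamily (Or.inl rfl),
    mem_constFamily (Or.inr rfl), mem_evenFamily, mem_rootFamily (Or.inl rfl),
    mem_rootFamily (Or.inr rfl), mem_coeffBox]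
  omega

lemma card_le_card_union_add {A B J : Finset (ℤ × ℤ × ℤ)} (h : A ∩ B ⊆ J) :
    A.card + B.card ≤ (A ∪ B).card + J.card := by
  have := Finset.card_union_add_card_inter A B
  have := Finset.card_le_card h
  omega

lemma card_principal_le (N : ℕ) : ((principal N).card : ℤ) ≤ 18 * N ^ 2 + 6 * N := by
  have h1 := Finset.card_union_le (constFamily 1 N ∪ constFamily (-1) N ∪ evenFamily N ∪
    rootFamily (-1) N) (rootFamily 1 N)
  have h2 := Finset.card_union_le (constFamily 1 N ∪ constFamily (-1) N ∪ evenFamily N)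
    (rootFamily (-1) N)
  have h3 := Finset.card_union_le (constFamily 1 N ∪ constFamily (-1) N) (evenFamily N)
  have h4 := Finset.card_union_le (constFamily 1 N) (constFamily (-1) N)
  rw [card_constFamily, card_constFamily] at h4
  rw [card_evenFamily] at h3
  have e1 := card_rootFamily 1 N
  have e2 := card_rootFamily (-1) N
  rw [← principal] at h1
  zify at h1 h2 h3 h4
  linarith

lemma le_card_principal (N : ℕ) : 18 * (N : ℤ) ^ 2 - 26 * N ≤ (principal N).card := by
  have h1 : constFamily 1 N ∩ constFamily (-1) N ⊆ overlap N := by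
    rintro ⟨a, b, c⟩
    simp only [Finset.mem_inter, mem_constFamily (Or.inl rfl), mem_constFamily (Or.inr rfl),
      mem_overlap, mem_coeffBox]
    omega
  have h2 : (constFamily 1 N ∪ constFamily (-1) N) ∩ evenFamily N ⊆ overlap N := by
    rintro ⟨a, b, c⟩
    simp only [Finset.mem_inter, Finset.mem_union, mem_constFamily (Or.inl rfl),
      mem_constFamily (Or.inr rfl), mem_evenFamily, mem_overlap, mem_coeffBox]
    omega
  have h3 : (constFamily 1 N ∪ constFamily (-1) N ∪ evenFamily N) ∩ rootFamily (-1) N ⊆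
      overlap N := by
    rintro ⟨a, b, c⟩
    simp only [Finset.mem_inter, Finset.mem_union, mem_constFamily (Or.inl rfl),
      mem_constFamily (Or.inr rfl), mem_evenFamily, mem_overlap, mem_coeffBox,
      mem_rootFamily (Or.inr rfl)]
    omega
  have h4 : (constFamily 1 N ∪ constFamily (-1) N ∪ evenFamily N ∪ rootFamily (-1) N) ∩
      rootFamily 1 N ⊆ overlap N := by
    rintro ⟨a, b, c⟩
    simp only [Finset.mem_inter, Finset.mem_union, mem_constFamily (Or.inl rfl),
      mem_constFamily (Or.inr rfl), mem_evenFamily, mem_overlap, mem_coeffBox,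
      mem_rootFamily (Or.inr rfl), mem_rootFamily (Or.inl rfl)]
    omega
  have g1 := card_le_card_union_add h1
  have g2 := card_le_card_union_add h2
  have g3 := card_le_card_union_add h3
  have g4 := card_le_card_union_add h4
  rw [card_constFamily, card_constFamily] at g1
  rw [card_evenFamily] at g2
  have e1 := card_rootFamily 1 N
  have e2 := card_rootFamily (-1) N
  have hJ := card_overlap_le N
  rw [← principal] at g4
  zify at g1 g2 g3 g4 hJ
  linarith

lemma mulDep_of_mem_principal {N : ℕ} {a b c : ℤ} (h : (a, b, c) ∈ principal N) :
    MulDep (nzRoots (quad a b c)) := by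
  obtain ⟨-, ha, h | h | ⟨hc, rfl⟩ | h | h⟩ := mem_principal.1 h
  · exact mulDep_quad_of_eq_or_neg ha (Or.inl h)
  · exact mulDep_quad_of_eq_or_neg ha (Or.inr h)
  · exact mulDep_quad_of_middle_eq_zero ha hc
  · refine mulDep_of_one_mem ((mem_nzRoots_quad ha 1).2 ⟨?_, one_ne_zero⟩)
    have : (a + b + c : ℂ) = 0 := by exact_mod_cast h
    linear_combination this
  · refine mulDep_of_neg_one_mem ((mem_nzRoots_quad ha (-1)).2 ⟨?_, by norm_num⟩)
    have : (a - b + c : ℂ) = 0 := by exact_mod_cast h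
    linear_combination this

lemma card_principal_le_ncard (N : ℕ) : (principal N).card ≤ (MstarSet 2 N).ncard := by
  classical
  rw [ncard_MstarSet_two]
  refine Finset.card_le_card ?_
  rintro ⟨a, b, c⟩ h
  obtain ⟨hbox, ha, -⟩ := mem_principal.1 h
  exact Finset.mem_filter.2 ⟨hbox, ha, mulDep_of_mem_principal h⟩

lemma ncard_le (N : ℕ) : ((MstarSet 2 N).ncard : ℝ) ≤ (principal N).card +
    (128 * N * (1 + Real.log (4 * N)) + 256 * N * (1 + Real.log (2 * N))) := by
  classical
  refine le_trans ?_ (add_le_add le_rfl (add_le_add (card_square_family_le N)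
    (card_ratFamily_le N)))
  rw [ncard_MstarSet_two]
  norm_cast
  refine le_trans (Finset.card_le_card ?_) ((Finset.card_union_le _ _).trans
    (Nat.add_le_add_left (Finset.card_union_le _ _) _))
  rintro ⟨a, b, c⟩ h
  obtain ⟨hbox, ha, hm⟩ := Finset.mem_filter.1 h
  simp only [Finset.mem_union, Finset.mem_filter, mem_principal]
  dsimp only at ha hm
  by_cases hc : c = 0
  · subst hc
    have := classification_of_const_eq_zero ha hm
    exact Or.inl ⟨hbox, ha, by omega⟩
  · rcases classification ha hc hm with h | h | h
    · exact Or.inl ⟨hbox, ha, by tauto⟩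
    · exact Or.inr (Or.inl ⟨hbox, ha, hc, h⟩)
    · exact Or.inr (Or.inr ⟨hbox, h⟩)

theorem stmt_16 :
    ∃ C : ℝ, 0 < C ∧ ∀ H : ℤ, 3 ≤ H →
      |((MstarSet 2 H).ncard : ℝ) - 18 * (H : ℝ) ^ 2| ≤ C * (H : ℝ) * Real.log H := by
  refine ⟨2000, by norm_num, fun H hH => ?_⟩
  lift H to ℕ using by omega with N
  rw [Int.cast_natCast]
  have hN : (3 : ℝ) ≤ N := by exact_mod_cast hH
  have hN0 : (0 : ℝ) < N := by linarith
  have hlog : 1 ≤ Real.log N := by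
    rw [Real.le_log_iff_exp_le hN0]
    exact Real.exp_one_lt_three.le.trans hN
  have l4 : Real.log (4 * N) ≤ 3 * Real.log N := by
    rw [show 3 * Real.log N = Real.log ((N : ℝ) ^ 3) by rw [Real.log_pow]; norm_num]
    have : (4 : ℝ) ≤ (N : ℝ) ^ 2 := by nlinarith
    exact Real.log_le_log (by positivity) (by nlinarith)
  have l2 : Real.log (2 * N) ≤ 3 * Real.log N :=
    (Real.log_le_log (by positivity) (by linarith)).trans l4
  have u := ncard_le N
  have l : ((principal N).card : ℝ) ≤ (MstarSet 2 N).ncard := by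
    exact_mod_cast card_principal_le_ncard N
  have pu : ((principal N).card : ℝ) ≤ 18 * N ^ 2 + 6 * N := by
    exact_mod_cast card_principal_le N
  have pl : 18 * (N : ℝ) ^ 2 - 26 * N ≤ (principal N).card := by
    exact_mod_cast le_card_principal N
  have m1 : (N : ℝ) ≤ N * Real.log N := le_mul_of_one_le_right hN0.le hlog
  have m4 : (N : ℝ) * Real.log (4 * N) ≤ N * (3 * Real.log N) :=
    mul_le_mul_of_nonneg_left l4 hN0.le
  have m2 : (N : ℝ) * Real.log (2 * N) ≤ N * (3 * Real.log N) :=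
    mul_le_mul_of_nonneg_left l2 hN0.le
  rw [abs_le]
  constructor <;> nlinarith
end

section
/- For every integer n ≥ 2 there exists a constant C > 0, depending only on n, such that for every integer H ≥ 3, |#P_n(H) − 2^n·H^(n−1)| ≤ C·H^(n−2), where #P_n(H) is the number of monic integer polynomials f of degree n and height at most H that are irreducible over ℤ and satisfy f(0) = 1 or f(0) = −1. -/
open Polynomial MeasureTheory

def Pset (n : ℕ) (H : ℤ) : Set (Polynomial ℤ) :=
  {f | f.Monic ∧ f.natDegree = n ∧ HeightLe f H ∧ Irreducible f ∧
       (f.coeff 0 = 1 ∨ f.coeff 0 = -1)}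

/-- Monic integer polynomials of degree `n` and height at most `H` with constant coefficient
`1` or `-1`. -/
def unitConstBox (n : ℕ) (H : ℤ) : Set (Polynomial ℤ) :=
  {f | f.Monic ∧ f.natDegree = n ∧ HeightLe f H ∧ (f.coeff 0 = 1 ∨ f.coeff 0 = -1)}

theorem unitConstBox_injOn (m : ℕ) (H : ℤ) :
    Set.InjOn (fun f : ℤ[X] => (f.coeff 0, fun i : Fin m => f.coeff (i + 1)))
      (unitConstBox (m + 1) H) := by
  rintro f ⟨hf, hfd, -, -⟩ g ⟨hg, hgd, -, -⟩ hfg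
  simp only [Prod.mk.injEq, funext_iff] at hfg
  ext i
  rcases i with _ | j
  · exact hfg.1
  rcases lt_trichotomy j m with hj | rfl | hj
  · exact hfg.2 ⟨j, hj⟩
  · rw [← hfd, hf.coeff_natDegree, hfd, ← hgd, hg.coeff_natDegree]
  · rw [coeff_eq_zero_of_natDegree_lt (by omega), coeff_eq_zero_of_natDegree_lt (by omega)]

theorem unitConstBox_image (m : ℕ) {H : ℤ} (hH : 1 ≤ H) :
    (fun f : ℤ[X] => (f.coeff 0, fun i : Fin m => f.coeff (i + 1))) '' unitConstBox (m + 1) H =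
      (({1, -1} ×ˢ Fintype.piFinset fun _ => Finset.Icc (-H) H : Finset (ℤ × (Fin m → ℤ))) :
        Set (ℤ × (Fin m → ℤ))) := by
  ext ⟨s, c⟩
  simp only [Set.mem_image, Prod.mk.injEq, Finset.mem_coe, Finset.mem_product, Finset.mem_insert,
    Finset.mem_singleton, Fintype.mem_piFinset, Finset.mem_Icc, ← abs_le]
  constructor
  · rintro ⟨f, ⟨-, -, hfH, hf0⟩, rfl, rfl⟩
    exact ⟨hf0, fun i => hfH _⟩
  rintro ⟨hs, hc⟩
  have hq : (X ^ m + ofFn m c).Monic := monic_X_pow_add (ofFn_degree_lt c)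
  have hqd : (X ^ m + ofFn m c).natDegree = m := by
    rw [natDegree_add_eq_left_of_degree_lt, natDegree_X_pow]
    simpa using ofFn_degree_lt c
  have hXq : (X * (X ^ m + ofFn m c)).natDegree = m + 1 := by
    rw [natDegree_X_mul hq.ne_zero, hqd]
  have h0 : (X * (X ^ m + ofFn m c) + C s).coeff 0 = s := by simp
  have hsucc (i : ℕ) : (X * (X ^ m + ofFn m c) + C s).coeff (i + 1) =
      (if i = m then 1 else 0) + (ofFn m c).coeff i := by
    rw [coeff_add, coeff_X_mul, coeff_C_succ, coeff_add, coeff_X_pow, add_zero]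
  refine ⟨X * (X ^ m + ofFn m c) + C s, ⟨?_, ?_, ?_, ?_⟩, h0, ?_⟩
  · refine (monic_X.mul hq).add_of_left (degree_C_le.trans_lt ?_)
    rw [← natDegree_pos_iff_degree_pos, hXq]
    omega
  · rw [natDegree_add_C, hXq]
  · rintro (_ | i)
    · rw [h0]
      rcases hs with rfl | rfl <;> simpa using hH
    · rw [hsucc]
      rcases lt_or_ge i m with hi | hi
      · simpa [hi.ne, ofFn_coeff_eq_val_of_lt _ hi] using hc ⟨i, hi⟩
      · rw [ofFn_coeff_eq_zero_of_ge _ hi]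
        split_ifs <;> simp <;> omega
  · rwa [h0]
  · funext i
    rw [hsucc]
    simp [i.2.ne]

theorem unitConstBox_finite (m : ℕ) {H : ℤ} (hH : 1 ≤ H) : (unitConstBox (m + 1) H).Finite := by
  refine Set.Finite.of_finite_image ?_ (unitConstBox_injOn m H)
  rw [unitConstBox_image m hH]
  exact Finset.finite_toSet _

theorem unitConstBox_ncard (m : ℕ) {H : ℤ} (hH : 1 ≤ H) :
    ((unitConstBox (m + 1) H).ncard : ℝ) = 2 * (2 * H + 1) ^ m := by
  rw [← (unitConstBox_injOn m H).ncard_image, unitConstBox_image m hH, Set.ncard_coe_finset,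
    Finset.card_product, Fintype.card_piFinset, Finset.card_pair (by norm_num)]
  simp only [Int.card_Icc, Finset.prod_const, Finset.card_univ, Fintype.card_fin]
  have h : (((H + 1 - -H).toNat : ℤ) : ℝ) = 2 * H + 1 := by
    rw [Int.toNat_of_nonneg (by omega)]
    push_cast
    ring
  push_cast at h ⊢
  rw [h]

theorem HeightLe.mahlerMeasure_le {f : ℤ[X]} {H : ℤ} (hf : HeightLe f H) :
    (f.map (Int.castRingHom ℂ)).mahlerMeasure ≤ (f.natDegree + 1) * H := by
  refine (mahlerMeasure_le_sum_norm_coeff _).trans ?_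
  rw [sum_over_range _ (by simp), natDegree_map_eq_of_injective (Int.castRingHom ℂ).injective_int]
  refine (Finset.sum_le_card_nsmul _ _ (H : ℝ) fun i _ => ?_).trans (by simp)
  simpa [coeff_map] using (Int.cast_le (R := ℝ)).2 (hf i)

/-- A factor of an integer polynomial of degree `n` and height at most `H` has height at most
`2 ^ n * (n + 1) * H`. -/
theorem HeightLe.of_mul {g h : ℤ[X]} {H : ℤ} (hg : g ≠ 0) (hh : h ≠ 0) (hgh : HeightLe (g * h) H) :
    HeightLe g (2 ^ (g * h).natDegree * ((g * h).natDegree + 1) * H) := by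
  intro i
  have hM := hgh.mahlerMeasure_le
  have hd : g.natDegree ≤ (g * h).natDegree := by
    rw [natDegree_mul hg hh]
    omega
  have hi := norm_coeff_le_choose_mul_mahlerMeasure_of_one_le_mahlerMeasure i
    (g.map (Int.castRingHom ℂ)) (h.map (Int.castRingHom ℂ)) (one_le_mahlerMeasure_of_ne_zero hh)
  rw [← Polynomial.map_mul, natDegree_map_eq_of_injective (Int.castRingHom ℂ).injective_int,
    coeff_map, eq_intCast, Complex.norm_intCast] at hi
  have hc : (g.natDegree.choose i : ℝ) ≤ 2 ^ (g * h).natDegree := by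
    exact_mod_cast (Nat.choose_le_two_pow _ _).trans (Nat.pow_le_pow_right (by norm_num) hd)
  have : (|g.coeff i| : ℝ) ≤ 2 ^ (g * h).natDegree * (((g * h).natDegree + 1) * H) :=
    hi.trans (mul_le_mul hc hM (mahlerMeasure_nonneg _) (by positivity))
  rw [mul_assoc]
  exact_mod_cast this

theorem unitConstBox_diff_Pset_subset {n : ℕ} (hn : 2 ≤ n) (H : ℤ) :
    unitConstBox n H \ Pset n H ⊆ ⋃ k ∈ Finset.range (n - 1),
      (fun p : ℤ[X] × ℤ[X] => p.1 * p.2) ''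
        (unitConstBox (k + 1) (2 ^ n * (n + 1) * H) ×ˢ
          unitConstBox (n - 2 - k + 1) (2 ^ n * (n + 1) * H)) := by
  rintro f ⟨⟨hf, hfd, hfH, hf0⟩, hfP⟩
  have hirr : ¬ Irreducible f := fun h => hfP ⟨hf, hfd, hfH, h, hf0⟩
  rw [hf.irreducible_iff_natDegree'] at hirr
  have hf1 : f ≠ 1 := by
    rintro rfl
    simp at hfd
    omega
  simp only [hf1, ne_eq, not_false_eq_true, true_and, not_forall, not_not, Finset.mem_Ioc] at hirr
  obtain ⟨g, h, hg, hh, rfl, hpos, hle⟩ := hirr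
  have hdeg := hg.natDegree_mul hh
  have hgH := hfH.of_mul hg.ne_zero hh.ne_zero
  have hhH : HeightLe h _ := HeightLe.of_mul hh.ne_zero hg.ne_zero (mul_comm g h ▸ hfH)
  rw [mul_comm h g] at hhH
  rw [hfd] at hgH hhH hdeg hle
  have hunit : IsUnit (g.coeff 0 * h.coeff 0) := by
    rwa [← mul_coeff_zero, Int.isUnit_iff]
  rw [IsUnit.mul_iff, Int.isUnit_iff, Int.isUnit_iff] at hunit
  simp only [Set.mem_iUnion, Finset.mem_range]
  exact ⟨g.natDegree - 1, by omega, (g, h),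
    ⟨⟨hg, by dsimp only; omega, hgH, hunit.1⟩, hh, by dsimp only; omega, hhH, hunit.2⟩, rfl⟩

theorem unitConstBox_diff_Pset_ncard_le {n : ℕ} (hn : 2 ≤ n) {H : ℤ} (hH : 1 ≤ H) :
    ((unitConstBox n H \ Pset n H).ncard : ℝ) ≤
      n * (4 * (3 * (2 ^ n * (n + 1) * H)) ^ (n - 2)) := by
  set K : ℤ := 2 ^ n * (n + 1) * H with hK
  have hK1 : 1 ≤ K := by
    have : (0 : ℤ) < 2 ^ n * (n + 1) * H := by positivity
    omega
  have hfin (k : ℕ) : ((fun p : ℤ[X] × ℤ[X] => p.1 * p.2) ''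
      (unitConstBox (k + 1) K ×ˢ unitConstBox (n - 2 - k + 1) K)).Finite :=
    ((unitConstBox_finite _ hK1).prod (unitConstBox_finite _ hK1)).image _
  have hcard : ∀ k ∈ Finset.range (n - 1), (((fun p : ℤ[X] × ℤ[X] => p.1 * p.2) ''
      (unitConstBox (k + 1) K ×ˢ unitConstBox (n - 2 - k + 1) K)).ncard : ℝ) ≤
        4 * (3 * (K : ℝ)) ^ (n - 2) := by
    intro k hk
    rw [Finset.mem_range] at hk
    have hKr : (1 : ℝ) ≤ K := by exact_mod_cast hK1
    calc _ ≤ (((unitConstBox (k + 1) K ×ˢ unitConstBox (n - 2 - k + 1) K).ncard : ℕ) : ℝ) := by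
          exact_mod_cast Set.ncard_image_le
            ((unitConstBox_finite _ hK1).prod (unitConstBox_finite _ hK1))
      _ = 4 * (2 * (K : ℝ) + 1) ^ (k + (n - 2 - k)) := by
          rw [Set.ncard_prod, Nat.cast_mul, unitConstBox_ncard _ hK1, unitConstBox_ncard _ hK1]
          ring
      _ = 4 * (2 * (K : ℝ) + 1) ^ (n - 2) := by rw [Nat.add_sub_cancel' (by omega)]
      _ ≤ _ := by
          gcongr
          linarith
  have hle := (Set.ncard_le_ncard (unitConstBox_diff_Pset_subset hn H)
    ((Finset.range (n - 1)).finite_toSet.biUnion fun k _ => hfin k)).trans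
      (Finset.set_ncard_biUnion_le _ _)
  calc ((unitConstBox n H \ Pset n H).ncard : ℝ) ≤ _ := Nat.cast_le.2 hle
    _ ≤ (n - 1 : ℕ) * (4 * (3 * (K : ℝ)) ^ (n - 2)) := by
        rw [Nat.cast_sum]
        exact (Finset.sum_le_card_nsmul _ _ _ hcard).trans (by simp)
    _ ≤ n * (4 * (3 * (K : ℝ)) ^ (n - 2)) := by
        have : (0 : ℝ) ≤ K := by exact_mod_cast zero_le_one.trans hK1
        gcongr
        omega
    _ = _ := by simp [hK]

theorem two_mul_two_mul_add_one_pow_sub_le (m : ℕ) {x : ℝ} (hx : 1 ≤ x) :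
    2 * (2 * x + 1) ^ m - 2 ^ (m + 1) * x ^ m ≤ 2 * (m * (3 * x) ^ (m - 1)) := by
  have h := (le_abs_self _).trans (abs_pow_sub_pow_le (2 * x + 1) (2 * x) m)
  rw [show 2 * x + 1 - 2 * x = 1 by ring, abs_one, one_mul, abs_of_nonneg (by linarith),
    abs_of_nonneg (by linarith), max_eq_left (by linarith)] at h
  have h3 : (m : ℝ) * (2 * x + 1) ^ (m - 1) ≤ m * (3 * x) ^ (m - 1) := by
    gcongr
    linarith
  rw [mul_pow] at h
  rw [pow_succ]
  linarith

theorem stmt_18 (n : ℕ) (hn : 2 ≤ n) :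
    ∃ C : ℝ, 0 < C ∧ ∀ H : ℤ, 3 ≤ H →
      |((Pset n H).ncard : ℝ) - 2 ^ n * (H : ℝ) ^ (n - 1)| ≤ C * (H : ℝ) ^ (n - 2) := by
  obtain ⟨m, rfl⟩ : ∃ m, n = m + 1 := ⟨n - 1, by omega⟩
  refine ⟨2 * m * 3 ^ (m - 1) + (m + 1) * (4 * (3 * (2 ^ (m + 1) * (m + 1 + 1))) ^ (m - 1)),
    by positivity, fun H hH => ?_⟩
  have hH1 : 1 ≤ H := by omega
  have hHr : (1 : ℝ) ≤ H := by exact_mod_cast hH1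
  have hsub : Pset (m + 1) H ⊆ unitConstBox (m + 1) H :=
    fun f ⟨hf, hfd, hfH, _, hf0⟩ => ⟨hf, hfd, hfH, hf0⟩
  have hadd : ((unitConstBox (m + 1) H \ Pset (m + 1) H).ncard : ℝ) + (Pset (m + 1) H).ncard =
      2 * (2 * H + 1) ^ m := by
    rw [← unitConstBox_ncard m hH1]
    exact_mod_cast Set.ncard_sdiff_add_ncard_of_subset hsub (unitConstBox_finite m hH1)
  have hred := unitConstBox_diff_Pset_ncard_le hn hH1
  have hbox := two_mul_two_mul_add_one_pow_sub_le m hHr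
  have hlow : (2 : ℝ) ^ (m + 1) * H ^ m ≤ 2 * (2 * H + 1) ^ m := by
    have : (2 * (H : ℝ)) ^ m ≤ (2 * H + 1) ^ m := by
      gcongr
      linarith
    rw [mul_pow] at this
    rw [pow_succ]
    linarith
  have hnn : (0 : ℝ) ≤ (unitConstBox (m + 1) H \ Pset (m + 1) H).ncard := Nat.cast_nonneg _
  rw [← mul_assoc (3 : ℝ), mul_pow _ (H : ℝ)] at hred
  rw [mul_pow] at hbox
  push_cast at hred
  rw [show m + 1 - 2 = m - 1 by omega]
  rw [Nat.add_sub_cancel, add_mul, abs_le]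
  have hA : (0 : ℝ) ≤ 2 * (m * (3 ^ (m - 1) * H ^ (m - 1))) := by positivity
  have hB := hnn.trans hred
  constructor <;> linarith
end
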